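/- arXiv:1204.3258 — 8 statements merged into one kernel-verified Lean document; each statement's English description precedes it below -/
import Mathlib

section
/- The class of all finite structures (X, ≺, <₁, <₂, E), where ≺ is a strict partial order, <₁ is a strict linear order extending ≺, <₂ is an arbitrary strict linear order, and E is a graph relation (symmetric and irreflexive), has the Ramsey property: for all A, B in this class and all r ∈ ℕ there exists C in this class such that every coloring χ : Emb(A,C) → Fin r is constant on {g ∘ f : f ∈ Emb(A,B)} for some g ∈ Emb(B,C). -/
/-- A relational structure with binary relations indexed by `ι`. -/
structure BinStr (ι : Type) : Type 1 where
  carrier : Type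
  rel : ι → carrier → carrier → Prop

/-- An embedding of such structures: an injective map that preserves and reflects
each of the relations. -/
structure BinEmb {ι : Type} (A B : BinStr ι) : Type where
  toFun : A.carrier → B.carrier
  inj : Function.Injective toFun
  map_rel : ∀ (i : ι) (x y : A.carrier), A.rel i x y ↔ B.rel i (toFun x) (toFun y)

/-- Composition of embeddings. -/
def BinEmb.comp {ι : Type} {A B C : BinStr ι} (g : BinEmb B C) (f : BinEmb A B) :
    BinEmb A C where
  toFun := g.toFun ∘ f.toFun
  inj := g.inj.comp f.inj
  map_rel i x y := (f.map_rel i x y).trans (g.map_rel i (f.toFun x) (f.toFun y))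

/-- The Ramsey property for a class of structures: for all `A, B` in the class and all
`r : ℕ` there is `C` in the class such that every colouring of the embeddings of `A` into `C`
with `r` colours is constant on the copies of `A` inside some copy of `B` in `C`. -/
def BinRamseyClass {ι : Type} (K : Set (BinStr ι)) : Prop :=
  ∀ A ∈ K, ∀ B ∈ K, ∀ r : ℕ, ∃ C ∈ K,
    ∀ χ : BinEmb A C → Fin r, ∃ g : BinEmb B C,
      ∀ f₁ f₂ : BinEmb A B, χ (g.comp f₁) = χ (g.comp f₂)

/-- The word `w` has letters below `m`, and each letter `j` with `a ≤ j < m` occurs in `w`, its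
first occurrence being preceded by smaller letters only. Thus `w` is a parameter word over the
alphabet `{0, …, a - 1}` with parameters `a, …, m - 1`. -/
def IsParamWord (a m : ℕ) (w : List ℕ) : Prop :=
  (∀ x ∈ w, x < m) ∧ ∀ j, a ≤ j → j < m → w.find? (fun x => j ≤ x) = some j

/-- The letter substituted for `x` when the letters below `a` are kept and the parameters
`a, a + 1, …` are replaced by the consecutive letters of `u`. -/
def substLetter (a : ℕ) (u : List ℕ) (x : ℕ) : ℕ :=
  if x < a then x else u.getD (x - a) 0

/-- Substitution of the word `u` for the parameters of the word `w`. -/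
def substWord (a : ℕ) (w u : List ℕ) : List ℕ :=
  w.map (substLetter a u)

lemma substLetter_of_lt {a x : ℕ} (u : List ℕ) (h : x < a) : substLetter a u x = x :=
  if_pos h

lemma substLetter_append_cons (a : ℕ) (u v : List ℕ) (j : ℕ) :
    substLetter a (u ++ j :: v) (a + u.length) = j := by
  simp [substLetter]

lemma substLetter_append_of_lt {a x : ℕ} (u v : List ℕ) (h : x < a + u.length) :
    substLetter a (u ++ v) x = substLetter a u x := by
  unfold substLetter
  split_ifs with hx
  · rfl
  · rw [List.getD_append _ _ _ _ (by omega)]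

lemma substWord_append_right_of_lt {a : ℕ} {w : List ℕ} (u v : List ℕ)
    (h : ∀ x ∈ w, x < a + u.length) : substWord a w (u ++ v) = substWord a w u :=
  List.map_congr_left fun x hx => substLetter_append_of_lt u v (h x hx)

lemma substLetter_mem_or_lt {a x : ℕ} (u : List ℕ) (h : x < a + u.length) :
    substLetter a u x ∈ u ∨ substLetter a u x < a := by
  unfold substLetter
  split_ifs with hx
  · exact Or.inr hx
  · left
    rw [List.getD_eq_getElem _ _ (by omega)]
    exact List.getElem_mem _

lemma substWord_lt {a b : ℕ} {w u : List ℕ} (hab : a ≤ b) (hw : ∀ x ∈ w, x < a + u.length)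
    (hu : ∀ x ∈ u, x < b) : ∀ x ∈ substWord a w u, x < b := by
  intro x hx
  obtain ⟨y, hy, rfl⟩ := List.mem_map.1 hx
  rcases substLetter_mem_or_lt u (hw y hy) with h | h
  · exact hu _ h
  · omega

@[simp] lemma length_substWord (a : ℕ) (w u : List ℕ) :
    (substWord a w u).length = w.length := by
  simp [substWord]

lemma substWord_append (a : ℕ) (w w' u : List ℕ) :
    substWord a (w ++ w') u = substWord a w u ++ substWord a w' u := by
  simp [substWord]

lemma substWord_assoc {a : ℕ} (ha : 0 < a) (w z u : List ℕ) :
    substWord a (substWord a w z) u = substWord a w (substWord a z u) := by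
  simp only [substWord, List.map_map]
  refine List.map_congr_left fun x _ => ?_
  simp only [Function.comp, substLetter]
  by_cases hx : x < a
  · simp [hx]
  · simp only [hx, if_false]
    by_cases hl : x - a < z.length
    · simp [hl, substLetter]
    · simp [not_lt.1 hl, ha]

lemma substWord_range' (a : ℕ) (u v : List ℕ) :
    substWord a (List.range' a u.length) (u ++ v) = u := by
  apply List.ext_getElem
  · simp
  · intro i h1 h2
    simp [substWord, substLetter, List.getElem?_append_left h2, List.getElem?_eq_getElem h2]

lemma IsParamWord.exists_eq_append {a m j : ℕ} {w : List ℕ} (h : IsParamWord a m w)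
    (h1 : a ≤ j) (h2 : j < m) : ∃ w' w'', w = w' ++ j :: w'' ∧ ∀ x ∈ w', x < j := by
  obtain ⟨-, w', w'', h3, h4⟩ := List.find?_eq_some_iff_append.1 (h.2 j h1 h2)
  exact ⟨w', w'', h3, by simpa using h4⟩

lemma find?_append_cons_of_lt {j : ℕ} {w' : List ℕ} (w'' : List ℕ) (h : ∀ x ∈ w', x < j) :
    (w' ++ j :: w'').find? (fun x => j ≤ x) = some j :=
  List.find?_eq_some_iff_append.2 ⟨by simp, w', w'', rfl, by simpa using h⟩

lemma isParamWord_append_cons_iff {a m : ℕ} {u v : List ℕ} (hu : ∀ x ∈ u, x < a) (ham : a < m) :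
    IsParamWord a m (u ++ a :: v) ↔ IsParamWord (a + 1) m v := by
  have key : ∀ j, a < j → (u ++ a :: v).find? (fun x => j ≤ x) = v.find? (fun x => j ≤ x) := by
    intro j hj
    have : u.find? (fun x => j ≤ x) = none := by
      simp only [List.find?_eq_none, decide_eq_true_eq, not_le]
      intro x hx
      have := hu x hx
      omega
    rw [List.find?_append, this, List.find?_cons_of_neg (by simpa using hj)]
    simp
  constructor
  · intro h
    refine ⟨fun x hx => h.1 x (by simp [hx]), fun j h1 h2 => ?_⟩
    rw [← key j (by omega)]
    exact h.2 j (by omega) h2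
  · intro h
    refine ⟨fun x hx => ?_, fun j h1 h2 => ?_⟩
    · simp only [List.mem_append, List.mem_cons] at hx
      rcases hx with hx | rfl | hx
      · exact (hu x hx).trans ham
      · exact ham
      · exact h.1 x hx
    · rcases h1.eq_or_lt with rfl | h1
      · exact find?_append_cons_of_lt v hu
      · rw [key j h1]
        exact h.2 j h1 h2

lemma IsParamWord.substWord {a k m : ℕ} {w u : List ℕ} (hw : IsParamWord a (a + k) w)
    (hu : IsParamWord a m u) (hk : u.length = k) (ham : a ≤ m) :
    IsParamWord a m (substWord a w u) := by
  subst hk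
  refine ⟨substWord_lt ham hw.1 hu.1, fun j h1 h2 => ?_⟩
  obtain ⟨u', u'', rfl, h3⟩ := hu.exists_eq_append h1 h2
  obtain ⟨w', w'', rfl, h4⟩ := hw.exists_eq_append (j := a + u'.length) (by omega) (by simp)
  rw [substWord_append, substWord_append_right_of_lt _ _ h4]
  simp only [_root_.substWord, List.map_cons, substLetter_append_cons]
  exact find?_append_cons_of_lt _ (substWord_lt h1 h4 h3)

/-- Substituting a parameter word `u ++ a :: v` into a parameter word splits the result at the
first occurrence of `a`. -/
lemma substWord_split {a m : ℕ} {z' z'' u v : List ℕ}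
    (hz : IsParamWord a (a + (u ++ a :: v).length) (z' ++ (a + u.length) :: z''))
    (hz' : ∀ x ∈ z', x < a + u.length) (hu : ∀ x ∈ u, x < a) (hv : IsParamWord (a + 1) m v)
    (ham : a < m) :
    substWord a (z' ++ (a + u.length) :: z'') (u ++ a :: v) =
        substWord a z' u ++ a :: substWord a z'' (u ++ a :: v) ∧
      (∀ x ∈ substWord a z' u, x < a) ∧
      IsParamWord (a + 1) m (substWord a z'' (u ++ a :: v)) := by
  have h1 : substWord a (z' ++ (a + u.length) :: z'') (u ++ a :: v) =
      substWord a z' u ++ a :: substWord a z'' (u ++ a :: v) := by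
    rw [substWord_append, substWord_append_right_of_lt _ _ hz']
    simp [substWord, substLetter_append_cons]
  have h2 := substWord_lt le_rfl hz' hu
  refine ⟨h1, h2, ?_⟩
  rw [← isParamWord_append_cons_iff h2 ham, ← h1]
  exact hz.substWord ((isParamWord_append_cons_iff hu ham).2 hv) rfl ham.le

/-- The Graham–Rothschild property for words over an alphabet of `a` letters with `p`
parameters. -/
def GrahamRothschild (a p : ℕ) : Prop :=
  ∀ (k : ℕ) (κ : Type) [Finite κ], ∃ n, ∀ χ : List ℕ → κ, ∃ w : List ℕ,
    IsParamWord a (a + k) w ∧ w.length = n ∧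
      ∃ c, ∀ u, IsParamWord a (a + p) u → u.length = k → χ (substWord a w u) = c

lemma exists_ofFn_eq {a k : ℕ} {u : List ℕ} (hk : u.length = k) (hu : ∀ x ∈ u, x < a) :
    ∃ f : Fin k → Fin a, u = List.ofFn fun i => (f i : ℕ) := by
  subst hk
  exact ⟨fun i => ⟨u[i], hu _ (List.getElem_mem _)⟩, by simp⟩

lemma range'_eq_append_cons (a d e : ℕ) : List.range' a (d + e + 1) =
    List.range' a d ++ (a + d) :: List.range' (a + d + 1) e := by
  rw [← List.range'_succ, List.range'_append_1, add_assoc]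

lemma isParamWord_range' (a k : ℕ) : IsParamWord a (a + k) (List.range' a k) := by
  refine ⟨fun x hx => by simp at hx; omega, fun j h1 h2 => ?_⟩
  obtain ⟨d, rfl⟩ := Nat.exists_eq_add_of_le h1
  obtain ⟨e, rfl⟩ := Nat.exists_eq_add_of_lt (Nat.lt_of_add_lt_add_left h2)
  rw [range'_eq_append_cons]
  exact find?_append_cons_of_lt _ (by simp)

/-- The Hales–Jewett theorem for words: no parameters are coloured. -/
lemma grahamRothschild_zero (a : ℕ) : GrahamRothschild a 0 := by
  intro k κ _
  obtain ⟨ι, _, h⟩ := Combinatorics.Line.exists_mono_in_high_dimension (Fin k → Fin a) κ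
  let block : Option (Fin k → Fin a) → List ℕ := fun o =>
    o.elim (List.range' a k) fun f => List.ofFn fun i => (f i : ℕ)
  have hblock : ∀ o, (block o).length = k := by rintro (_ | f) <;> simp [block]
  refine ⟨(Finset.univ : Finset ι).toList.length * k, fun χ => ?_⟩
  obtain ⟨l, c, hc⟩ := h fun x =>
    χ ((Finset.univ : Finset ι).toList.flatMap fun i => block (some (x i)))
  refine ⟨(Finset.univ : Finset ι).toList.flatMap fun i => block (l.idxFun i), ⟨?_, ?_⟩, ?_, c, ?_⟩
  · intro x hx
    obtain ⟨i, -, hi⟩ := List.mem_flatMap.1 hx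
    rcases hl : l.idxFun i with _ | f
    · simp only [hl, block, Option.elim, List.mem_range'_1] at hi
      exact hi.2
    · simp only [hl, block, Option.elim, List.mem_ofFn] at hi
      obtain ⟨t, rfl⟩ := hi
      exact (f t).2.trans_le (Nat.le_add_right _ _)
  · intro j h1 h2
    obtain ⟨i, hi⟩ := l.proper
    have key : ∀ L : List ι, i ∈ L →
        (L.flatMap fun i => block (l.idxFun i)).find? (fun x => j ≤ x) = some j := by
      intro L
      induction L with
      | nil => simp
      | cons t L ih =>
        intro ht
        rw [List.flatMap_cons, List.find?_append]
        rcases hl : l.idxFun t with _ | f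
        · simp [block, (isParamWord_range' a k).2 j h1 h2]
        · have : (block (some f)).find? (fun x => j ≤ x) = none := by
            simp only [block, Option.elim, List.find?_eq_none, List.mem_ofFn]
            rintro _ ⟨s, rfl⟩
            have := (f s).2
            simp
            omega
          rw [this, Option.none_or]
          refine ih ?_
          rcases List.mem_cons.1 ht with rfl | ht
          · simp [hl] at hi
          · exact ht
    exact key _ (by simp)
  · simp [List.length_flatMap, hblock]
  · intro u hu hk
    obtain ⟨f, rfl⟩ := exists_ofFn_eq hk hu.1
    rw [← hc f, substWord, List.map_flatMap]
    congr 1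
    refine List.flatMap_congr fun i _ => ?_
    rw [l.coe_apply]
    rcases l.idxFun i with _ | g
    · have := substWord_range' a (List.ofFn fun i => (f i : ℕ)) []
      simpa [block, substWord] using this
    · apply List.ext_getElem
      · simp [block]
      · intro i h1 h2
        simp [block, substLetter_of_lt]

/-- Every colouring can be refined so that the colour of `u ++ a :: v` depends on the prefix `u`
only, as long as `u` is shorter than `i`. -/
lemma exists_prefix_determined_color {a p : ℕ} (ha : 0 < a) (h : GrahamRothschild (a + 1) p)
    (κ : Type) [Finite κ] (i d : ℕ) :
    ∃ n, ∀ χ : List ℕ → κ, ∃ w, IsParamWord a (a + (i + d)) w ∧ w.length = n ∧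
      ∃ γ : List ℕ → κ, ∀ u v, u.length < i → (∀ x ∈ u, x < a) →
        IsParamWord (a + 1) (a + 1 + p) v → (u ++ a :: v).length = i + d →
          χ (substWord a w (u ++ a :: v)) = γ u := by
  induction i generalizing d with
  | zero =>
    exact ⟨d, fun χ => ⟨List.range' a d, by simpa using isParamWord_range' a d, by simp, χ,
      by simp⟩⟩
  | succ i ih =>
    obtain ⟨n₁, h₁⟩ := h d ((Fin i → Fin a) → κ)
    obtain ⟨n, h₀⟩ := ih (1 + n₁)
    refine ⟨n, fun χ => ?_⟩
    obtain ⟨w, hw, hwn, γ, hγ⟩ := h₀ χ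
    obtain ⟨t, ht, htn, c, hc⟩ := h₁ fun v f =>
      χ (substWord a w ((List.ofFn fun s => (f s : ℕ)) ++ a :: v))
    set t' := t.map fun x => if x < a then x else x + i with ht'
    set z := List.range' a (i + 1) ++ t' with hz
    have hzsplit : ∀ l ≤ i, ∃ z'', z = List.range' a l ++ (a + l) :: z'' := by
      intro l hl
      obtain ⟨e, rfl⟩ := Nat.exists_eq_add_of_le hl
      refine ⟨List.range' (a + l + 1) e ++ t', ?_⟩
      rw [hz, range'_eq_append_cons]
      simp
    have hzlen : z.length = i + (1 + n₁) := by simp [hz, ht', htn]; omega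
    have hzw : IsParamWord a (a + (i + 1 + d)) z := by
      refine ⟨?_, fun j h1 h2 => ?_⟩
      · intro x hx
        rcases List.mem_append.1 hx with hx | hx
        · simp at hx; omega
        · obtain ⟨y, hy, rfl⟩ := List.mem_map.1 hx
          have := ht.1 y hy
          split_ifs <;> omega
      · by_cases hj : j ≤ a + i
        · obtain ⟨z'', hz''⟩ := hzsplit (j - a) (by omega)
          rw [hz'', Nat.add_sub_cancel' h1]
          exact find?_append_cons_of_lt _ fun x hx => by simp at hx; omega
        · obtain ⟨t₁, t₂, ht₁, ht₂⟩ := ht.exists_eq_append (j := j - i) (by omega) (by omega)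
          have : z = (List.range' a (i + 1) ++ t₁.map fun x => if x < a then x else x + i) ++
              j :: t₂.map fun x => if x < a then x else x + i := by
            rw [hz, ht', ht₁]
            simp only [List.map_append, List.map_cons, List.append_assoc]
            rw [if_neg (by omega), Nat.sub_add_cancel (by omega)]
          rw [this]
          refine find?_append_cons_of_lt _ fun x hx => ?_
          rcases List.mem_append.1 hx with hx | hx
          · simp at hx; omega
          · obtain ⟨y, hy, rfl⟩ := List.mem_map.1 hx
            have := ht₂ y hy
            split_ifs <;> omega
    refine ⟨substWord a w z, hw.substWord hzw hzlen (by omega), by simp [hwn],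
      fun u => if u.length < i then γ u else
        c fun s => ⟨u.getD s 0 % a, Nat.mod_lt _ ha⟩, fun u v hui hu hv huv => ?_⟩
    rw [substWord_assoc ha]
    beta_reduce
    split_ifs with hui'
    · obtain ⟨z'', hz''⟩ := hzsplit u.length (by omega)
      have hzw' := hzw
      rw [hz''] at hzw' ⊢
      rw [← huv] at hzw'
      obtain ⟨h1, -, h3⟩ := substWord_split hzw' (by simp) hu hv (by omega)
      have h4 : substWord a (List.range' a u.length) u = u := by
        simpa using substWord_range' a u []
      rw [h4] at h1
      rw [h1]
      refine hγ u _ hui' hu h3 ?_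
      rw [← h1, ← hz'', length_substWord, hzlen]
    · obtain rfl : u.length = i := by omega
      obtain ⟨f, hf⟩ := exists_ofFn_eq rfl hu
      have h1 : substWord a z (u ++ a :: v) = u ++ a :: substWord (a + 1) t v := by
        rw [hz, substWord_append, ← List.range'_append_1, substWord_append, substWord_range',
          List.append_assoc]
        congr 1
        simp only [substWord, List.range'_one, List.map_cons, List.map_nil,
          substLetter_append_cons, List.cons_append, List.nil_append, ht', List.map_map]
        congr 1
        refine List.map_congr_left fun x _ => ?_
        simp only [Function.comp]
        rcases lt_trichotomy x a with hx | rfl | hx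
        · rw [if_pos hx, substLetter_of_lt _ hx, substLetter_of_lt _ (by omega)]
        · rw [if_neg (lt_irrefl _), substLetter_append_cons, substLetter_of_lt _ (by omega)]
        · obtain ⟨e, rfl⟩ := Nat.exists_eq_add_of_lt hx
          rw [if_neg (by omega)]
          simp only [substLetter]
          rw [if_neg (by omega), if_neg (by omega), List.getD_append_right _ _ _ _ (by omega)]
          have e1 : a + e + 1 + u.length - a - u.length = e + 1 := by omega
          have e2 : a + e + 1 - (a + 1) = e := by omega
          rw [e1, e2, List.getD_cons_succ]
      have h2 : (fun s : Fin u.length => (⟨u.getD s 0 % a, Nat.mod_lt _ ha⟩ : Fin a)) = f := by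
        funext s
        apply Fin.ext
        have h3 : u.getD s 0 = f s :=
          (List.getD_eq_getElem _ _ s.2).trans ((List.getElem_of_eq hf s.2).trans (by simp))
        simp only [h3]
        exact Nat.mod_eq_of_lt (f s).2
      rw [h1, h2, ← congrFun (hc v hv (by simp at huv; omega)) f, ← hf]

/-- Every colouring of words can be refined so that, for each `i < k`, the prefix in front of the
first occurrence of the parameter `a + i` gets a colour depending on `i` only. -/
lemma exists_prefix_color_levels {a : ℕ} (ha : 0 < a) (κ : Type) [Finite κ] (k : ℕ) :
    ∃ n, ∀ γ : List ℕ → κ, ∃ w, IsParamWord a (a + k) w ∧ w.length = n ∧ ∃ c : ℕ → κ,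
      ∀ i < k, ∃ w' w'', w = w' ++ (a + i) :: w'' ∧ (∀ x ∈ w', x < a + i) ∧
        ∀ u, u.length = i → (∀ x ∈ u, x < a) → γ (substWord a w' u) = c i := by
  induction k with
  | zero => exact ⟨0, fun γ => ⟨[], by simpa using isParamWord_range' a 0, rfl, fun _ => γ [],
      by simp⟩⟩
  | succ k ih =>
    obtain ⟨n, ih⟩ := ih
    obtain ⟨N, hN⟩ := grahamRothschild_zero a n κ
    refine ⟨N + 1, fun γ => ?_⟩
    obtain ⟨w, hw, hwN, c₀, hc₀⟩ := hN γ
    obtain ⟨z, hz, hzn, c, hc⟩ := ih fun u =>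
      γ (substWord a (w.takeWhile fun x => x < a + u.length) u)
    have hwz := hw.substWord hz hzn (by omega)
    refine ⟨substWord a w z ++ [a + k], ⟨?_, ?_⟩, by simp [hwN],
      fun i => if i < k then c i else c₀, fun i hi => ?_⟩
    · intro x hx
      rcases List.mem_append.1 hx with hx | hx
      · have := hwz.1 x hx; omega
      · simp at hx; omega
    · intro j h1 h2
      rcases (show j ≤ a + k by omega).eq_or_lt with rfl | h2
      · exact find?_append_cons_of_lt _ hwz.1
      · rw [List.find?_append, hwz.2 j h1 h2, Option.some_or]
    · by_cases hik : i < k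
      · obtain ⟨z', z'', rfl, h1, h2⟩ := hc i hik
        obtain ⟨w', w'', rfl, h3⟩ := hw.exists_eq_append (j := a + z'.length) (by omega)
          (by simp at hzn; omega)
        refine ⟨substWord a w' z', substWord a w'' (z' ++ (a + i) :: z'') ++ [a + k], ?_, ?_, ?_⟩
        · rw [substWord_append, substWord_append_right_of_lt _ _ h3]
          simp [substWord, substLetter_append_cons]
        · exact substWord_lt (by omega) h3 h1
        · intro u hui hu
          have := h2 u hui hu
          beta_reduce
          rw [if_pos hik, ← this, substWord_assoc ha, length_substWord,
            List.takeWhile_append_of_pos (by simpa using h3)]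
          simp
      · obtain rfl : i = k := by omega
        refine ⟨substWord a w z, [], rfl, hwz.1, fun u hui hu => ?_⟩
        beta_reduce
        rw [if_neg hik, substWord_assoc ha]
        refine hc₀ _ ⟨?_, fun j h1 h2 => by omega⟩ (by simp [hzn])
        exact substWord_lt le_rfl (by rw [hui]; exact hz.1) hu

lemma exists_paramWord_of_le_count {a : ℕ} (ha : 0 < a) (P : ℕ → Prop) [DecidablePred P]
    (n k : ℕ) (hk : k ≤ Nat.count P n) :
    ∃ w, IsParamWord a (a + k) w ∧ w.length = n ∧ ∀ i < k, ∃ w' w'', w = w' ++ (a + i) :: w'' ∧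
      (∀ x ∈ w', x < a + i) ∧ P w'.length := by
  induction n generalizing k with
  | zero =>
    obtain rfl : k = 0 := by simpa using hk
    exact ⟨[], by simpa using isParamWord_range' a 0, rfl, by simp⟩
  | succ n ih =>
    by_cases h : k ≤ Nat.count P n
    · obtain ⟨w, hw, hwn, h1⟩ := ih k h
      refine ⟨w ++ [0], ⟨?_, fun j h2 h3 => ?_⟩, by simp [hwn], fun i hi => ?_⟩
      · intro x hx
        rcases List.mem_append.1 hx with hx | hx
        · exact hw.1 x hx
        · simp at hx; omega
      · rw [List.find?_append, hw.2 j h2 h3, Option.some_or]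
      · obtain ⟨w', w'', rfl, h2, h3⟩ := h1 i hi
        exact ⟨w', w'' ++ [0], by simp, h2, h3⟩
    · rw [Nat.count_succ] at hk
      have hP : P n := by
        by_contra hP
        simp [hP] at hk
        omega
      simp only [hP, if_true] at hk
      obtain ⟨l, rfl⟩ : ∃ l, k = l + 1 := ⟨k - 1, by omega⟩
      obtain ⟨w, hw, hwn, h1⟩ := ih l (by omega)
      refine ⟨w ++ [a + l], ⟨?_, fun j h2 h3 => ?_⟩, by simp [hwn], fun i hi => ?_⟩
      · intro x hx
        rcases List.mem_append.1 hx with hx | hx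
        · have := hw.1 x hx; omega
        · simp at hx; omega
      · rcases (show j ≤ a + l by omega).eq_or_lt with rfl | h3
        · exact find?_append_cons_of_lt _ hw.1
        · rw [List.find?_append, hw.2 j h2 h3, Option.some_or]
      · rcases (show i ≤ l by omega).eq_or_lt with rfl | hi
        · exact ⟨w, [], rfl, hw.1, by rwa [hwn]⟩
        · obtain ⟨w', w'', rfl, h2, h3⟩ := h1 i hi
          exact ⟨w', w'' ++ [a + l], by simp, h2, h3⟩

lemma exists_le_count (κ : Type) [Finite κ] (k : ℕ) :
    ∃ n, ∀ c : ℕ → κ, ∃ y, ∃ _ : DecidablePred fun i => c i = y,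
      k ≤ Nat.count (fun i => c i = y) n := by
  classical
  have := Fintype.ofFinite κ
  refine ⟨Fintype.card κ * k + 1, fun c => ?_⟩
  obtain ⟨y, -, hy⟩ := Finset.exists_lt_card_fiber_of_mul_lt_card_of_maps_to
    (s := Finset.range (Fintype.card κ * k + 1)) (t := Finset.univ) (f := c) (n := k)
    (by simp) (by simp)
  exact ⟨y, inferInstance, by rw [Nat.count_eq_card_filter_range]; exact hy.le⟩

lemma GrahamRothschild.succ {a p : ℕ} (ha : 0 < a) (h : GrahamRothschild (a + 1) p) :
    GrahamRothschild a (p + 1) := by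
  intro k κ _
  obtain ⟨K, hK⟩ := exists_le_count κ k
  obtain ⟨M, hM⟩ := exists_prefix_color_levels ha κ K
  obtain ⟨n, hn⟩ := exists_prefix_determined_color ha h κ M 0
  refine ⟨n, fun χ => ?_⟩
  obtain ⟨w, hw, hwn, γ, hγ⟩ := hn χ
  obtain ⟨y, hy, hyM, c, hc⟩ := hM γ
  obtain ⟨c₀, _, hc₀⟩ := hK c
  obtain ⟨z, hz, hzK, hzc⟩ := exists_paramWord_of_le_count ha _ K k hc₀
  have hyz := hy.substWord hz hzK (by omega)
  refine ⟨substWord a w (substWord a y z), hw.substWord hyz (by simp [hyM]) (by omega),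
    by simp [hwn], c₀, fun u hu huk => ?_⟩
  obtain ⟨u, v, rfl, hua⟩ := hu.exists_eq_append le_rfl (by omega)
  rw [isParamWord_append_cons_iff hua (by omega)] at hu
  obtain ⟨z', z'', rfl, h1, h2⟩ := hzc u.length (by simp at huk; omega)
  rw [← huk] at hz
  obtain ⟨e1, l1, hv1⟩ := substWord_split hz h1 hua hu (by omega)
  obtain ⟨y', y'', rfl, h3, h4⟩ := hc z'.length (by simp at hzK; omega)
  have hlen : (substWord a z' u).length = z'.length := length_substWord _ _ _
  rw [← hlen] at hy h3
  rw [← hzK, ← length_substWord a _ (u ++ a :: v), e1] at hy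
  obtain ⟨e2, l2, hv2⟩ := substWord_split hy h3 l1 hv1 (by omega)
  have hM' := (congrArg List.length e2).symm.trans ((length_substWord _ _ _).trans (hlen ▸ hyM))
  rw [substWord_assoc ha, substWord_assoc ha, e1, ← hlen, e2, hγ _ _ ?_ l2 ?_ hM',
    h4 _ hlen l1, h2]
  · rw [List.length_append, List.length_cons] at hM'
    omega
  · rwa [show a + 1 + p = a + (p + 1) by omega]

theorem grahamRothschild {a : ℕ} (ha : 0 < a) (p : ℕ) : GrahamRothschild a p := by
  induction p generalizing a with
  | zero => exact grahamRothschild_zero a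
  | succ p ih => exact (ih (Nat.succ_pos a)).succ ha

/-- A map between (strictly ordered) sets is rigid if every point `b` of the target is attained,
and is attained for the first time after values below `b` only. -/
def IsRigid {α β : Type} (r : α → α → Prop) (s : β → β → Prop) (ρ : α → β) : Prop :=
  ∀ b, ∃ a, ρ a = b ∧ ∀ a', r a' a → s (ρ a') b

lemma IsRigid.comp {α β γ : Type} {r : α → α → Prop} {s : β → β → Prop} {t : γ → γ → Prop}
    {σ : β → γ} {ρ : α → β} (hσ : IsRigid s t σ) (hρ : IsRigid r s ρ) : IsRigid r t (σ ∘ ρ) := by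
  intro c
  obtain ⟨b, rfl, hb⟩ := hσ c
  obtain ⟨a, rfl, ha⟩ := hρ b
  exact ⟨a, rfl, fun a' h => hb _ (ha a' h)⟩

lemma exists_equiv_fin_of_isStrictTotalOrder {S : Type} [Finite S] [Nonempty S]
    (r : S → S → Prop) [IsStrictTotalOrder S r] :
    ∃ (p : ℕ) (e : Fin (p + 1) ≃ S), ∀ i j, i < j ↔ r (e i) (e j) := by
  classical
  let _ := Fintype.ofFinite S
  let _ := linearOrderOfSTO r
  obtain ⟨p, hp⟩ := Nat.exists_eq_succ_of_ne_zero (Fintype.card_ne_zero (α := S))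
  let e := Fintype.orderIsoFinOfCardEq S hp
  exact ⟨p, e.toEquiv, fun i j => e.lt_iff_lt.symm⟩

/-- The finite dual Ramsey theorem, for rigid maps. -/
theorem dual_ramsey {S T : Type} [Finite S] [Nonempty S] [Finite T] [Nonempty T]
    (r : S → S → Prop) (s : T → T → Prop) [IsStrictTotalOrder S r] [IsStrictTotalOrder T s]
    (κ : Type) [Finite κ] :
    ∃ n, ∀ χ : (Fin n → S) → κ, ∃ w : Fin n → T, IsRigid (· < ·) s w ∧
      ∃ c, ∀ ρ : T → S, IsRigid s r ρ → χ (ρ ∘ w) = c := by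
  obtain ⟨p, e, he⟩ := exists_equiv_fin_of_isStrictTotalOrder r
  obtain ⟨k, e', he'⟩ := exists_equiv_fin_of_isStrictTotalOrder s
  obtain ⟨n, hn⟩ := grahamRothschild one_pos p k κ
  refine ⟨n + 1, fun χ => ?_⟩
  obtain ⟨w, hw, hwn, c, hc⟩ := hn fun l => χ fun i => e (Fin.ofNat (p + 1) ((0 :: l).getD i 0))
  have hw₀ : IsParamWord 0 (1 + k) (0 :: w) :=
    (isParamWord_append_cons_iff (u := []) (by simp) (by omega)).2 hw
  have hwlt : ∀ i : Fin (n + 1), (0 :: w).getD i 0 < k + 1 := by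
    intro i
    rw [List.getD_eq_getElem _ _ (by simp [hwn]; omega)]
    have := hw₀.1 _ (List.getElem_mem (l := 0 :: w) (n := i) (by simp [hwn]; omega))
    omega
  refine ⟨fun i => e' ⟨(0 :: w).getD i 0, hwlt i⟩, fun b => ?_, c, fun ρ hρ => ?_⟩
  · obtain ⟨j, rfl⟩ := e'.surjective b
    obtain ⟨w', w'', h1, h2⟩ := hw₀.exists_eq_append (j := j) (by omega) (by omega)
    have hlen := congrArg List.length h1
    simp only [List.length_cons, List.length_append] at hlen
    refine ⟨⟨w'.length, by omega⟩, ?_, fun i hi => ?_⟩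
    · simp only [h1]
      congr
      simp
    · rw [← he']
      have hi' : i.1 < w'.length := hi
      simp only [h1, Fin.lt_def]
      rw [List.getD_append _ _ _ _ hi', List.getD_eq_getElem _ _ hi']
      exact h2 _ (List.getElem_mem _)
  · set u := List.ofFn fun i : Fin k => (e.symm (ρ (e' i.succ)) : ℕ) with hu
    have h0 : e.symm (ρ (e' 0)) = 0 := by
      obtain ⟨t, ht, ht'⟩ := hρ (e 0)
      obtain ⟨j, rfl⟩ := e'.surjective t
      rcases eq_or_ne j 0 with rfl | hj
      · rw [ht, e.symm_apply_apply]
      · have := ht' (e' 0) ((he' _ _).1 (Fin.pos_iff_ne_zero.2 hj))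
        rw [← e.apply_symm_apply (ρ (e' 0)), ← he] at this
        exact absurd this (Fin.not_lt_zero _)
    have hu0 : (0 :: u) = List.ofFn fun i : Fin (k + 1) => (e.symm (ρ (e' i)) : ℕ) := by
      rw [List.ofFn_succ, h0, hu]
      rfl
    have hget : ∀ x : Fin (k + 1), substLetter 1 u x = e.symm (ρ (e' x)) := by
      intro x
      have h1 : substLetter 1 u x = (0 :: u).getD x 0 := by
        rcases x with ⟨_ | x, hx⟩ <;> simp [substLetter]
      rw [h1, hu0, List.getD_eq_getElem _ _ (by simp; omega)]
      exact List.getElem_ofFn _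
    have hpw : IsParamWord 1 (1 + p) u := by
      rw [← isParamWord_append_cons_iff (a := 0) (u := []) (by simp) (by omega), List.nil_append,
        hu0]
      refine ⟨?_, fun j _ hj => ?_⟩
      · intro x hx
        obtain ⟨i, rfl⟩ := (List.mem_ofFn' _ _).1 hx
        have := (e.symm (ρ (e' i))).2
        dsimp only
        omega
      · obtain ⟨t, ht, ht'⟩ := hρ (e ⟨j, by omega⟩)
        obtain ⟨i, rfl⟩ := e'.surjective t
        rw [List.find?_eq_some_iff_getElem]
        refine ⟨by simp, i, by simp; omega,
          by simp only [List.getElem_ofFn, ht, Equiv.symm_apply_apply], fun i' hi' => ?_⟩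
        have h1 := ht' (e' ⟨i', by omega⟩) ((he' _ _).1 hi')
        rw [← e.apply_symm_apply (ρ _), ← he] at h1
        rw [List.getElem_ofFn]
        simpa [Fin.lt_def] using h1
    rw [← hc u hpw (by simp [hu])]
    congr 1
    funext i
    have h1 : 0 :: substWord 1 w u = substWord 1 (0 :: w) u := by
      simp [substWord, substLetter]
    have h2 : (0 :: substWord 1 w u).getD i 0 = substLetter 1 u ((0 :: w).getD i 0) := by
      rw [h1, List.getD_eq_getElem _ _ (by simp [hwn]; omega),
        List.getD_eq_getElem _ _ (by simp [hwn]; omega)]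
      simp only [substWord, List.getElem_map]
    rw [h2, hget ⟨_, hwlt i⟩, Fin.ofNat_val_eq_self, e.apply_symm_apply]
    rfl

/-- The lexicographic comparison of sets: the first point at which `s` and `t` differ is in
`t`. -/
def setLex {J : Type} (r : J → J → Prop) (s t : Set J) : Prop :=
  ∃ j, j ∉ s ∧ j ∈ t ∧ ∀ i, r i j → (i ∈ s ↔ i ∈ t)

lemma isStrictTotalOrder_setLex {J : Type} [Finite J] (r : J → J → Prop)
    [IsStrictTotalOrder J r] : IsStrictTotalOrder (Set J) (setLex r) where
  irrefl := by
    rintro s ⟨j, h1, h2, -⟩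
    exact h1 h2
  trans := by
    rintro s t u ⟨j, h1, h2, h3⟩ ⟨k, h4, h5, h6⟩
    rcases trichotomous_of r j k with h | rfl | h
    · exact ⟨j, h1, (h6 j h).1 h2, fun i hi => (h3 i hi).trans (h6 i (_root_.trans hi h))⟩
    · exact absurd h2 h4
    · exact ⟨k, fun hk => h4 ((h3 k h).1 hk), h5,
        fun i hi => (h3 i (_root_.trans hi h)).trans (h6 i hi)⟩
  trichotomous := by
    intro s t h1 h2
    by_contra hne
    have hex : ∃ j, ¬ (j ∈ s ↔ j ∈ t) := by
      by_contra! h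
      exact hne (Set.ext h)
    have hwf : WellFounded r := Finite.wellFounded_of_trans_of_irrefl r
    have hmin : ∀ i, r i (hwf.min _ hex) → (i ∈ s ↔ i ∈ t) := fun i hi =>
      not_not.1 fun hn => hwf.not_lt_min {j | ¬ (j ∈ s ↔ j ∈ t)} hn hi
    have hm : ¬ (hwf.min _ hex ∈ s ↔ hwf.min _ hex ∈ t) := hwf.min_mem _ hex
    by_cases h : hwf.min _ hex ∈ s
    · exact h2 ⟨_, fun ht => hm (iff_of_true h ht), h, fun i hi => (hmin i hi).symm⟩
    · exact h1 ⟨_, h, by_contra fun ht => hm (iff_of_false h ht), hmin⟩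

lemma setLex_preimage {α β : Type} {r : α → α → Prop} {s : β → β → Prop} {ρ : α → β}
    (hρ : IsRigid r s ρ) {x y : Set β} (h : setLex s x y) : setLex r (ρ ⁻¹' x) (ρ ⁻¹' y) := by
  obtain ⟨b, h1, h2, h3⟩ := h
  obtain ⟨a, rfl, ha⟩ := hρ b
  exact ⟨a, h1, h2, fun i hi => h3 _ (ha i hi)⟩

lemma rel_iff_of_imp {α β : Type} {r : α → α → Prop} {s : β → β → Prop}
    (hr : IsStrictTotalOrder α r) (hs : IsStrictTotalOrder β s) (f : α → β)
    (h : ∀ a b, r a b → s (f a) (f b)) (a b : α) : r a b ↔ s (f a) (f b) :=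
  (RelEmbedding.ofMonotone f h).map_rel_iff.symm

/-- The comparison of tagged points: first the tags are compared, after applying the permutation
`σ`; points with the same tag `i` are compared by `r i`. -/
def tagLex {α : Type} (σ : Equiv.Perm (Fin 3)) (r : Fin 3 → α → α → Prop) (x y : Fin 3 × α) :
    Prop :=
  σ x.1 < σ y.1 ∨ x.1 = y.1 ∧ r x.1 x.2 y.2

lemma isStrictTotalOrder_tagLex {α : Type} (σ : Equiv.Perm (Fin 3)) {r : Fin 3 → α → α → Prop}
    (hr : ∀ i, IsStrictTotalOrder α (r i)) : IsStrictTotalOrder (Fin 3 × α) (tagLex σ r) where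
  irrefl := by
    rintro ⟨i, x⟩ (h | ⟨-, h⟩)
    · exact lt_irrefl _ h
    · exact irrefl_of (r i) x h
  trans := by
    rintro ⟨i, x⟩ ⟨j, y⟩ ⟨k, z⟩ (h | ⟨h, h'⟩) (h₁ | ⟨h₁, h₁'⟩)
    · exact Or.inl (h.trans h₁)
    · exact Or.inl (by simp_all)
    · exact Or.inl (by simp_all)
    · obtain rfl : i = j := h
      obtain rfl : i = k := h₁
      exact Or.inr ⟨rfl, trans_of (r i) h' h₁'⟩
  trichotomous := by
    rintro ⟨i, x⟩ ⟨j, y⟩ h1 h2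
    rcases lt_trichotomy (σ i) (σ j) with h | h | h
    · exact absurd (Or.inl h) h1
    · obtain rfl := σ.injective h
      rcases trichotomous_of (r i) x y with h | rfl | h
      · exact absurd (Or.inr ⟨rfl, h⟩) h1
      · rfl
      · exact absurd (Or.inr ⟨rfl, h⟩) h2
    · exact absurd (Or.inl h) h2

lemma IsRigid.prodMap {α β : Type} {r : α → α → Prop} {s : β → β → Prop} {ρ : α → β}
    (hρ : IsRigid r s ρ) (σ : Equiv.Perm (Fin 3)) :
    IsRigid (tagLex σ fun _ => r) (tagLex σ fun _ => s) (Prod.map id ρ) := by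
  rintro ⟨i, b⟩
  obtain ⟨a, rfl, ha⟩ := hρ b
  refine ⟨(i, a), rfl, ?_⟩
  rintro ⟨j, c⟩ (h | ⟨rfl, h⟩)
  · exact Or.inl h
  · exact Or.inr ⟨rfl, ha c h⟩

/-- Finite structures consisting of a strict partial order, a linear extension of it, a second
linear order and a graph. -/
structure IsOrderedPosetGraph (A : BinStr (Fin 4)) : Prop where
  finite : Finite A.carrier
  strictOrder : IsStrictOrder A.carrier (A.rel 0)
  linear₁ : IsStrictTotalOrder A.carrier (A.rel 1)
  extends_rel : ∀ x y : A.carrier, A.rel 0 x y → A.rel 1 x y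
  linear₂ : IsStrictTotalOrder A.carrier (A.rel 2)
  symm : ∀ x y : A.carrier, A.rel 3 x y → A.rel 3 y x
  irrefl : ∀ x : A.carrier, ¬ A.rel 3 x x

/-- The structure on triples of subsets of `T`: the partial order is strict inclusion of the first
components, the linear orders are lexicographic with the first, respectively the second, component
dominating, and distinct triples are adjacent if their third components meet. -/
def cube {T : Type} (r : T → T → Prop) : BinStr (Fin 4) where
  carrier := Set (Fin 3 × T)
  rel := ![
    fun x y => Prod.mk 0 ⁻¹' x ⊂ Prod.mk 0 ⁻¹' y,
    setLex (tagLex 1 fun _ => r),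
    setLex (tagLex (Equiv.swap 0 1) fun _ => r),
    fun x y => x ≠ y ∧ ∃ t, (2, t) ∈ x ∧ (2, t) ∈ y]

lemma isOrderedPosetGraph_cube {T : Type} [Finite T] (r : T → T → Prop)
    [hr : IsStrictTotalOrder T r] : IsOrderedPosetGraph (cube r) := by
  have h1 := isStrictTotalOrder_tagLex 1 fun _ => hr
  have h2 := isStrictTotalOrder_tagLex (Equiv.swap 0 1) fun _ => hr
  have h3 := isStrictTotalOrder_setLex (tagLex 1 fun _ => r)
  refine ⟨inferInstanceAs (Finite (Set (Fin 3 × T))),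
    { irrefl := fun x => ssubset_irrefl (Prod.mk 0 ⁻¹' x)
      trans := fun x y z h h' => LE.le.trans_ssubset h.1 h' }, h3, ?_,
    isStrictTotalOrder_setLex (tagLex (Equiv.swap 0 1) fun _ => r), ?_, fun x h => h.1 rfl⟩
  · intro (x : Set (Fin 3 × T)) (y : Set (Fin 3 × T)) hxy
    have hxy : Prod.mk 0 ⁻¹' x ⊂ Prod.mk 0 ⁻¹' y := hxy
    rcases trichotomous_of (setLex (tagLex 1 fun _ => r)) x y with h | rfl | h
    · exact h
    · exact absurd hxy (ssubset_irrefl _)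
    · obtain ⟨⟨i, t⟩, h4, h5, h6⟩ := h
      rcases eq_or_ne i 0 with rfl | hi
      · exact absurd (hxy.1 h5) h4
      · refine absurd (fun a ha => ?_) hxy.2
        exact (h6 (0, a) (Or.inl (Fin.pos_iff_ne_zero.2 hi))).1 ha
  · rintro x y ⟨h, t, hx, hy⟩
    exact ⟨h.symm, t, hy, hx⟩

/-- A rigid map of index sets induces an embedding of cubes. -/
def cubeMap {T T' : Type} [Finite T] [Finite T'] {r : T → T → Prop} {r' : T' → T' → Prop}
    [hr : IsStrictTotalOrder T r] [hr' : IsStrictTotalOrder T' r'] (w : T' → T)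
    (hw : IsRigid r' r w) : BinEmb (cube r) (cube r') where
  toFun := fun x : Set (Fin 3 × T) => (Prod.map id w ⁻¹' x : Set (Fin 3 × T'))
  inj := by
    refine Set.preimage_injective.2 fun p => ?_
    obtain ⟨a, ha, -⟩ := hw.prodMap 1 p
    exact ⟨a, ha⟩
  map_rel := by
    have hsurj : Function.Surjective w := fun b => (hw b).imp fun _ h => h.1
    have hsurj' : Function.Surjective (Prod.map (id : Fin 3 → Fin 3) w) :=
      Function.surjective_id.prodMap hsurj
    have hpre : ∀ x : Set (Fin 3 × T),
        (Prod.mk 0 ⁻¹' (Prod.map id w ⁻¹' x) : Set T') = w ⁻¹' (Prod.mk 0 ⁻¹' x) := fun _ => rfl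
    intro i (x : Set (Fin 3 × T)) (y : Set (Fin 3 × T))
    fin_cases i
    · change Prod.mk 0 ⁻¹' x ⊂ Prod.mk 0 ⁻¹' y ↔
        Prod.mk 0 ⁻¹' (Prod.map id w ⁻¹' x) ⊂ Prod.mk 0 ⁻¹' (Prod.map id w ⁻¹' y)
      rw [hpre, hpre, ssubset_iff_subset_not_subset, ssubset_iff_subset_not_subset,
        hsurj.preimage_subset_preimage_iff, hsurj.preimage_subset_preimage_iff]
    · exact rel_iff_of_imp (isOrderedPosetGraph_cube r).linear₁
        (isOrderedPosetGraph_cube r').linear₁ _ (fun _ _ => setLex_preimage (hw.prodMap 1)) x y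
    · exact rel_iff_of_imp (isOrderedPosetGraph_cube r).linear₂
        (isOrderedPosetGraph_cube r').linear₂ _ (fun _ _ => setLex_preimage (hw.prodMap _)) x y
    · refine and_congr hsurj'.preimage_injective.ne_iff.symm ?_
      exact hsurj.exists

/-- The partial order on tagged points of `A`: the given partial order on points tagged by `0`, the
second linear order on points tagged by `1`, and equality on points tagged by `2`. -/
def tagPartial (A : BinStr (Fin 4)) (x y : Fin 3 × A.carrier) : Prop :=
  x.1 = y.1 ∧ (![A.rel 0, A.rel 2, fun _ _ => False] : Fin 3 → _) x.1 x.2 y.2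

/-- A linear order on tagged points of `A` extending `tagPartial A`. -/
def tagLinear (A : BinStr (Fin 4)) : Fin 3 × A.carrier → Fin 3 × A.carrier → Prop :=
  tagLex 1 ![A.rel 1, A.rel 2, A.rel 1]

/-- Triples consisting of an upper set, a final segment of the second linear order, and a
clique. -/
def Column (A : BinStr (Fin 4)) : Type :=
  {t : Set (Fin 3 × A.carrier) // (∀ x y, tagPartial A x y → x ∈ t → y ∈ t) ∧
    ∀ x y, (2, x) ∈ t → (2, y) ∈ t → x ≠ y → A.rel 3 x y}

/-- Columns are compared lexicographically. -/
def columnLT (A : BinStr (Fin 4)) (t t' : Column A) : Prop :=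
  setLex (tagLinear A) t.1 t'.1

instance (A : BinStr (Fin 4)) : Nonempty (Column A) :=
  ⟨⟨∅, by simp, by simp⟩⟩

/-- The upper closure of a set of tagged points. -/
def tagUpper (A : BinStr (Fin 4)) (u : Set (Fin 3 × A.carrier)) : Set (Fin 3 × A.carrier) :=
  {y | ∃ x ∈ u, x = y ∨ tagPartial A x y}

section

variable {A B : BinStr (Fin 4)}

lemma IsOrderedPosetGraph.finite_column (hA : IsOrderedPosetGraph A) : Finite (Column A) := by
  have := hA.finite
  exact inferInstanceAs (Finite {t : Set (Fin 3 × A.carrier) // _})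

lemma IsOrderedPosetGraph.tagLinear (hA : IsOrderedPosetGraph A) :
    IsStrictTotalOrder _ (tagLinear A) :=
  isStrictTotalOrder_tagLex 1 fun i => by
    fin_cases i
    exacts [hA.linear₁, hA.linear₂, hA.linear₁]

lemma IsOrderedPosetGraph.columnLT (hA : IsOrderedPosetGraph A) :
    IsStrictTotalOrder _ (columnLT A) := by
  have := hA.finite
  have := hA.tagLinear
  have h := isStrictTotalOrder_setLex (_root_.tagLinear A)
  exact
    { irrefl := fun t => h.irrefl t.1
      trans := fun t t' t'' => h.trans t.1 t'.1 t''.1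
      trichotomous := fun t t' h1 h2 => Subtype.ext (h.trichotomous t.1 t'.1 h1 h2) }

lemma IsOrderedPosetGraph.tagLinear_of_tagPartial (hA : IsOrderedPosetGraph A)
    {x y : Fin 3 × A.carrier} (h : tagPartial A x y) : _root_.tagLinear A x y := by
  obtain ⟨i, x⟩ := x
  obtain ⟨j, y⟩ := y
  obtain ⟨h1, h2⟩ := h
  obtain rfl : i = j := h1
  refine Or.inr ⟨rfl, ?_⟩
  fin_cases i
  · exact hA.extends_rel x y h2
  · exact h2
  · exact absurd h2 id

lemma IsOrderedPosetGraph.tagPartial_trans (hA : IsOrderedPosetGraph A)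
    {x y z : Fin 3 × A.carrier} (h : tagPartial A x y) (h' : tagPartial A y z) :
    tagPartial A x z := by
  obtain ⟨i, x⟩ := x
  obtain ⟨j, y⟩ := y
  obtain ⟨k, z⟩ := z
  obtain ⟨h1, h2⟩ := h
  obtain ⟨h3, h4⟩ := h'
  obtain rfl : i = j := h1
  obtain rfl : i = k := h3
  refine ⟨rfl, ?_⟩
  have := hA.strictOrder
  have := hA.linear₂
  fin_cases i
  · exact trans_of (A.rel 0) h2 h4
  · exact trans_of (A.rel 2) h2 h4
  · exact h2

lemma IsOrderedPosetGraph.tagUpper_upper (hA : IsOrderedPosetGraph A)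
    (u : Set (Fin 3 × A.carrier)) (x y : Fin 3 × A.carrier) (h : tagPartial A x y)
    (hx : x ∈ tagUpper A u) : y ∈ tagUpper A u := by
  obtain ⟨z, hz, rfl | hzx⟩ := hx
  · exact ⟨z, hz, Or.inr h⟩
  · exact ⟨z, hz, Or.inr (hA.tagPartial_trans hzx h)⟩

lemma mem_tagUpper_two {u : Set (Fin 3 × A.carrier)} {x : A.carrier} :
    (2, x) ∈ tagUpper A u ↔ (2, x) ∈ u := by
  refine ⟨?_, fun h => ⟨_, h, Or.inl rfl⟩⟩
  rintro ⟨⟨i, y⟩, hy, h | ⟨h, hxy⟩⟩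
  · rwa [← h]
  · obtain rfl : i = 2 := h
    exact absurd hxy id

/-- The column of points above a given tagged point. -/
def IsOrderedPosetGraph.principal (hA : IsOrderedPosetGraph A) (x : Fin 3 × A.carrier) :
    Column A :=
  ⟨tagUpper A {x}, hA.tagUpper_upper _, fun y z hy hz hne => by
    rw [mem_tagUpper_two] at hy hz
    exact absurd (congrArg Prod.snd (hy.trans hz.symm)) hne⟩

lemma IsOrderedPosetGraph.mem_principal_self (hA : IsOrderedPosetGraph A)
    (x : Fin 3 × A.carrier) : x ∈ (hA.principal x).1 :=
  ⟨x, rfl, Or.inl rfl⟩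

lemma IsOrderedPosetGraph.notMem_principal (hA : IsOrderedPosetGraph A)
    {x y : Fin 3 × A.carrier} (h : _root_.tagLinear A x y) : x ∉ (hA.principal y).1 := by
  have := hA.tagLinear
  rintro ⟨_, rfl, rfl | hyx⟩
  · exact irrefl_of (_root_.tagLinear A) _ h
  · exact asymm_of (_root_.tagLinear A) h (hA.tagLinear_of_tagPartial hyx)

/-- If `x` is below `y`, then the first column separating them contains `y`. -/
lemma IsOrderedPosetGraph.mem_iff_mem_of_columnLT_principal (hA : IsOrderedPosetGraph A)
    {x y : Fin 3 × A.carrier} (h : _root_.tagLinear A x y) {t : Column A}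
    (ht : _root_.columnLT A t (hA.principal y)) : x ∈ t.1 ↔ y ∈ t.1 := by
  have := hA.tagLinear
  obtain ⟨j, h1, ⟨_, rfl, rfl | h2⟩, h3⟩ := ht
  · exact iff_of_false (fun hx => hA.notMem_principal h ((h3 x h).1 hx)) h1
  · exact absurd (t.2.1 _ _ h2 ((h3 _ (hA.tagLinear_of_tagPartial h2)).2
      (hA.mem_principal_self _))) h1

lemma IsOrderedPosetGraph.setLex_encode (hA : IsOrderedPosetGraph A) (σ : Equiv.Perm (Fin 3))
    {i : Fin 3} (hi : σ i = 0) {x y : A.carrier} (h : _root_.tagLinear A (i, x) (i, y)) :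
    setLex (tagLex σ fun _ => _root_.columnLT A) {p | (p.1, x) ∈ p.2.1}
      {p | (p.1, y) ∈ p.2.1} := by
  refine ⟨(i, hA.principal (i, y)), hA.notMem_principal h, hA.mem_principal_self _, ?_⟩
  rintro ⟨j, t⟩ (hj | ⟨hj, ht⟩)
  · rw [hi] at hj
    exact absurd hj (Fin.not_lt_zero _)
  · obtain rfl : j = i := hj
    exact hA.mem_iff_mem_of_columnLT_principal h ht

/-- The embedding of a structure into the cube over its columns. -/
def IsOrderedPosetGraph.encode (hA : IsOrderedPosetGraph A) : BinEmb A (cube (_root_.columnLT A)) :=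
  have hcube : IsOrderedPosetGraph (cube (_root_.columnLT A)) := by
    have := hA.columnLT
    have := hA.finite_column
    exact isOrderedPosetGraph_cube _
  have h₁ : ∀ x y, A.rel 1 x y ↔ setLex (tagLex 1 fun _ => _root_.columnLT A)
      {p | (p.1, x) ∈ p.2.1} {p | (p.1, y) ∈ p.2.1} :=
    rel_iff_of_imp hA.linear₁ hcube.linear₁ _ fun x y h =>
      hA.setLex_encode 1 (i := 0) rfl (Or.inr ⟨rfl, h⟩)
  have hinj : Function.Injective fun x : A.carrier =>
      {p : Fin 3 × Column A | (p.1, x) ∈ p.2.1} := by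
    intro x y hxy
    have := hA.linear₁
    have hirr := hcube.linear₁.irrefl
    rcases trichotomous_of (A.rel 1) x y with h | h | h
    · have h' := (h₁ x y).1 h
      beta_reduce at hxy
      rw [hxy] at h'
      exact absurd h' (hirr _)
    · exact h
    · have h' := (h₁ y x).1 h
      beta_reduce at hxy
      rw [hxy] at h'
      exact absurd h' (hirr _)
  { toFun := fun x => {p : Fin 3 × Column A | (p.1, x) ∈ p.2.1}
    inj := hinj
    map_rel := by
      intro i x y
      fin_cases i
      · refine ⟨fun h => ⟨fun t => t.2.1 _ _ ⟨rfl, h⟩, fun h' => ?_⟩, fun h => ?_⟩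
        · exact hA.notMem_principal (x := (0, x)) (y := (0, y)) (Or.inr ⟨rfl, hA.extends_rel x y h⟩)
            (@h' (hA.principal (0, y)) (hA.mem_principal_self (0, y)))
        · obtain ⟨_, rfl, hxy | hxy⟩ := @h.1 (hA.principal (0, x)) (hA.mem_principal_self (0, x))
          · obtain rfl : x = y := congrArg Prod.snd hxy
            exact absurd h.1 h.2
          · exact hxy.2
      · exact h₁ x y
      · exact rel_iff_of_imp hA.linear₂ hcube.linear₂ _ (fun x y h =>
          hA.setLex_encode (Equiv.swap 0 1) (x := x) (y := y) (i := 1) (by simp)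
            (Or.inr ⟨rfl, h⟩)) x y
      · refine ⟨fun h => ⟨fun hxy => ?_, ?_⟩, fun ⟨hne, t, hx, hy⟩ => ?_⟩
        · obtain rfl := hinj hxy
          exact hA.irrefl x h
        · refine ⟨⟨{(2, x), (2, y)}, ?_, ?_⟩, Or.inl rfl, Or.inr rfl⟩
          · rintro _ z ⟨-, h'⟩ (rfl | rfl) <;> exact absurd h' id
          · rintro a b (ha | ha) (hb | hb) hab <;> cases ha <;> cases hb
            · exact absurd rfl hab
            · exact h
            · exact hA.symm _ _ h
            · exact absurd rfl hab
        · refine t.2.2 x y hx hy ?_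
          rintro rfl
          exact hne rfl }

lemma BinEmb.tagPartial_iff (f : BinEmb A B) (x y : Fin 3 × A.carrier) :
    tagPartial A x y ↔ tagPartial B (Prod.map id f.toFun x) (Prod.map id f.toFun y) := by
  obtain ⟨i, x⟩ := x
  refine and_congr Iff.rfl ?_
  fin_cases i
  · exact f.map_rel 0 _ _
  · exact f.map_rel 2 _ _
  · exact Iff.rfl

lemma BinEmb.tagLinear_map (f : BinEmb A B) {x y : Fin 3 × A.carrier} (h : tagLinear A x y) :
    tagLinear B (Prod.map id f.toFun x) (Prod.map id f.toFun y) := by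
  obtain ⟨i, x⟩ := x
  refine h.imp id fun h => ⟨h.1, ?_⟩
  have h2 := h.2
  fin_cases i
  · exact (f.map_rel 1 _ _).1 h2
  · exact (f.map_rel 2 _ _).1 h2
  · exact (f.map_rel 1 _ _).1 h2

/-- Restriction of columns along an embedding. -/
def Column.comap (f : BinEmb A B) (t : Column B) : Column A :=
  ⟨Prod.map id f.toFun ⁻¹' t.1, fun x y h => t.2.1 _ _ ((f.tagPartial_iff x y).1 h),
    fun x y hx hy hne => (f.map_rel 3 x y).2 (t.2.2 _ _ hx hy (f.inj.ne hne))⟩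

lemma Column.isRigid_comap (hB : IsOrderedPosetGraph B) (f : BinEmb A B) :
    IsRigid (columnLT B) (columnLT A) (Column.comap f) := by
  have hinj : Function.Injective (Prod.map (id : Fin 3 → Fin 3) f.toFun) :=
    Function.injective_id.prodMap f.inj
  intro u
  have hclique : ∀ x y, (2, x) ∈ tagUpper B (Prod.map id f.toFun '' u.1) →
      (2, y) ∈ tagUpper B (Prod.map id f.toFun '' u.1) → x ≠ y → B.rel 3 x y := by
    intro x y hx hy hne
    rw [mem_tagUpper_two] at hx hy
    obtain ⟨⟨i, a⟩, ha, hx⟩ := hx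
    obtain ⟨⟨j, b⟩, hb, hy⟩ := hy
    cases hx
    cases hy
    exact (f.map_rel 3 a b).1 (u.2.2 a b ha hb fun hab => hne (congrArg _ hab))
  have hcomap : ∀ x, Prod.map id f.toFun x ∈ tagUpper B (Prod.map id f.toFun '' u.1) ↔
      x ∈ u.1 := by
    refine fun x => ⟨?_, fun hx => ⟨_, ⟨x, hx, rfl⟩, Or.inl rfl⟩⟩
    rintro ⟨_, ⟨y, hy, rfl⟩, h | h⟩
    · rwa [← hinj h]
    · exact u.2.1 _ _ ((f.tagPartial_iff _ _).2 h) hy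
  refine ⟨⟨tagUpper B (Prod.map id f.toFun '' u.1), hB.tagUpper_upper _, hclique⟩,
    Subtype.ext (Set.ext hcomap), ?_⟩
  rintro t ⟨j, h1, ⟨_, ⟨i, hi, rfl⟩, rfl | h2⟩, h3⟩
  · exact ⟨i, h1, hi, fun i' hi' => (h3 _ (f.tagLinear_map hi')).trans (hcomap i')⟩
  · exact absurd (t.2.1 _ _ h2 ((h3 _ (hB.tagLinear_of_tagPartial h2)).2 ((hcomap i).2 hi))) h1

end

theorem exists_ramsey_of_isOrderedPosetGraph {A B : BinStr (Fin 4)} (hA : IsOrderedPosetGraph A)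
    (hB : IsOrderedPosetGraph B) (r : ℕ) : ∃ C, IsOrderedPosetGraph C ∧
      ∀ χ : BinEmb A C → Fin r, ∃ g : BinEmb B C,
        ∀ f₁ f₂ : BinEmb A B, χ (g.comp f₁) = χ (g.comp f₂) := by
  classical
  have := hA.columnLT
  have := hB.columnLT
  have := hA.finite_column
  have := hB.finite_column
  obtain ⟨n, hn⟩ := dual_ramsey (columnLT A) (columnLT B) (Option (Fin r))
  refine ⟨cube (fun i j : Fin n => i < j), isOrderedPosetGraph_cube _, fun χ => ?_⟩
  obtain ⟨w, hw, c, hc⟩ := hn fun v =>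
    if hv : IsRigid (· < ·) (columnLT A) v then some (χ ((cubeMap v hv).comp hA.encode)) else none
  have key : ∀ f : BinEmb A B, some (χ (((cubeMap w hw).comp hB.encode).comp f)) = c := by
    intro f
    have hf := Column.isRigid_comap hB f
    rw [← hc _ hf, dif_pos (hf.comp hw)]
    rfl
  exact ⟨(cubeMap w hw).comp hB.encode, fun f₁ f₂ =>
    Option.some_injective _ ((key f₁).trans (key f₂).symm)⟩

/-- The class of all finite structures `(X, ≺, <₁, <₂, E)`, where `≺` (index 0) is a strict
partial order, `<₁` (index 1) is a strict linear order extending `≺`, `<₂` (index 2) is an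
arbitrary strict linear order, and `E` (index 3) is a graph relation (symmetric and
irreflexive), has the Ramsey property. -/
theorem statement7 :
    BinRamseyClass {A : BinStr (Fin 4) |
      Finite A.carrier ∧
        IsStrictOrder A.carrier (A.rel 0) ∧
        IsStrictTotalOrder A.carrier (A.rel 1) ∧
        (∀ x y : A.carrier, A.rel 0 x y → A.rel 1 x y) ∧
        IsStrictTotalOrder A.carrier (A.rel 2) ∧
        (∀ x y : A.carrier, A.rel 3 x y → A.rel 3 y x) ∧
        (∀ x : A.carrier, ¬ A.rel 3 x x)} := by
  rintro A ⟨a1, a2, a3, a4, a5, a6, a7⟩ B ⟨b1, b2, b3, b4, b5, b6, b7⟩ r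
  obtain ⟨C, ⟨c1, c2, c3, c4, c5, c6, c7⟩, hC⟩ := exists_ramsey_of_isOrderedPosetGraph
    ⟨a1, a2, a3, a4, a5, a6, a7⟩ ⟨b1, b2, b3, b4, b5, b6, b7⟩ r
  exact ⟨C, ⟨c1, c2, c3, c4, c5, c6, c7⟩, hC⟩
end

section
/- Let Γ and Δ be countable structures in the same relational signature such that Γ is homogeneous and ω-categorical, Δ is a model-complete core, and Γ and Δ are homomorphically equivalent (there exist homomorphisms h : Γ → Δ and i : Δ → Γ). Then Δ is homogeneous. -/
open FirstOrder FirstOrder.Language CategoryTheory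

universe u v u' v' w w'

/-- A structure is a core if every endomorphism (homomorphism to itself) is an embedding. -/
def IsCore (L : FirstOrder.Language.{u, v}) (M : Type w) [L.Structure M] : Prop :=
  ∀ h : M →[L] M, ∃ e : M ↪[L] M, ⇑e = ⇑h

/-- A structure is model-complete if every self-embedding is locally generated by
automorphisms: for every self-embedding `e` and every finite tuple `t` there is an
automorphism `α` agreeing with `e` on `t`. -/
def IsModelComplete (L : FirstOrder.Language.{u, v}) (M : Type w) [L.Structure M] : Prop :=
  ∀ (e : M ↪[L] M) (n : ℕ) (t : Fin n → M), ∃ α : M ≃[L] M, ∀ i, e (t i) = α (t i)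

/-- A model-complete core. -/
def IsModelCompleteCore (L : FirstOrder.Language.{u, v}) (M : Type w) [L.Structure M] : Prop :=
  IsCore L M ∧ IsModelComplete L M

/-- A structure `M` is ω-categorical if its complete first-order theory has exactly one
countably infinite model up to isomorphism. -/
def IsOmegaCategorical (L : FirstOrder.Language.{u, v}) (M : Type w) [L.Structure M] : Prop :=
  ∃ N : Theory.ModelType.{u, v, w} (L.completeTheory M), Countable N ∧ Infinite N ∧
    ∀ N' : Theory.ModelType.{u, v, w} (L.completeTheory M),
      Countable N' → Infinite N' → Nonempty (N' ≃[L] N)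

/-- If a composition of homomorphisms `g.comp f` is an embedding, then so is `f`. -/
def FirstOrder.Language.Hom.embeddingOfComp {L : FirstOrder.Language.{u, v}}
    {M : Type w} {N : Type w'} {P : Type u'} [L.Structure M] [L.Structure N] [L.Structure P]
    (f : M →[L] N) (g : N →[L] P) (e : M ↪[L] P) (he : ⇑e = g.comp f) : M ↪[L] N where
  toFun := f
  inj' x y hxy := e.injective (by simp [he, hxy])
  map_fun' := f.map_fun
  map_rel' r x := ⟨fun hr => (e.map_rel r x).1 (by rw [he]; exact g.map_rel r _ hr), f.map_rel r x⟩

/-- If `Γ` is a countable homogeneous ω-categorical structure and `Δ` is a model-complete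
core (in the same relational signature) homomorphically equivalent to `Γ`, then `Δ` is
homogeneous. -/
theorem statement8 (L : FirstOrder.Language.{u, v}) [L.IsRelational]
    (Γ : Type w) (Δ : Type w') [Countable Γ] [Countable Δ]
    [L.Structure Γ] [L.Structure Δ]
    (hΓhom : L.IsUltrahomogeneous Γ) (hΓcat : IsOmegaCategorical L Γ)
    (hΔ : IsModelCompleteCore L Δ)
    (h : Nonempty (Γ →[L] Δ)) (i : Nonempty (Δ →[L] Γ)) :
    L.IsUltrahomogeneous Δ := by
  obtain ⟨h⟩ := h
  obtain ⟨i⟩ := i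
  obtain ⟨hcore, hmc⟩ := hΔ
  obtain ⟨e₂, he₂⟩ := hcore (h.comp i)
  let j := i.embeddingOfComp h e₂ he₂
  intro S hS f
  obtain ⟨α, hα⟩ := hΓhom (S.map j.toHom) (hS.map j.toHom)
    ((j.comp f).comp (j.substructureEquivMap S).symm.toEmbedding)
  have hαj (a : S) : α (i a) = i (f a) := by
    have : α (j a) = j (f a) := by
      simpa using (DFunLike.congr_fun hα (j.substructureEquivMap S a)).symm
    exact this
  obtain ⟨e₁, he₁⟩ := hcore ((h.comp α.toHom).comp i)
  have : Finite S := hS.finite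
  obtain ⟨n, ⟨t⟩⟩ := Finite.exists_equiv_fin S
  obtain ⟨β₁, hβ₁⟩ := hmc e₁ n fun k => t.symm k
  obtain ⟨β₂, hβ₂⟩ := hmc e₂ n fun k => f (t.symm k)
  refine ⟨β₂.symm.comp β₁, ?_⟩
  ext a
  have h₁ := hβ₁ (t a)
  have h₂ := hβ₂ (t a)
  simp only [he₁, he₂, Equiv.symm_apply_apply] at h₁ h₂
  apply β₂.injective
  simp [← h₁, ← h₂, hαj]
end

section
/- Let Γ and Δ be countable structures in the same relational signature such that Γ is ω-categorical, homogeneous, and Ramsey (the class of finite structures embedding into Γ has the Ramsey property with respect to embeddings), Δ is a model-complete core, and Γ and Δ are homomorphically equivalent. Then Δ is Ramsey. -/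
open FirstOrder FirstOrder.Language CategoryTheory

universe u v u' v' w w'

/-- The partition arrow `C → (B)^A_r`: for every colouring of the embeddings of `A` into `C`
with `r` colours there is an embedding `g` of `B` into `C` such that the colouring is constant
on the copies of `A` inside the copy `g[B]` of `B`. -/
def RamseyArrow {L : FirstOrder.Language.{u, v}} (A B C : Bundled.{w} L.Structure) (r : ℕ) :
    Prop :=
  ∀ χ : (A ↪[L] C) → Fin r, ∃ g : B ↪[L] C,
    ∀ f₁ f₂ : A ↪[L] B, χ (g.comp f₁) = χ (g.comp f₂)

/-- A class of structures has the Ramsey property if for all members `A, B` and all `r : ℕ`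
there is a member `C` with `C → (B)^A_r`. -/
def IsRamseyClass {L : FirstOrder.Language.{u, v}} (K : Set (Bundled.{w} L.Structure)) : Prop :=
  ∀ A ∈ K, ∀ B ∈ K, ∀ r : ℕ, ∃ C ∈ K, RamseyArrow A B C r

/-- The age of a structure `M`: the class of all finite structures that embed into `M`. -/
def Age (L : FirstOrder.Language.{u, v}) (M : Type w) [L.Structure M] :
    Set (Bundled.{w} L.Structure) :=
  {A | Finite A ∧ Nonempty (A ↪[L] M)}

/-- A structure is Ramsey if its age has the Ramsey property. -/
def IsRamseyStructure (L : FirstOrder.Language.{u, v}) (M : Type w) [L.Structure M] : Prop :=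
  IsRamseyClass (Age L M)

/-- If a composite `g ∘ f` of homomorphisms is an embedding, then so is `f`. -/
theorem exists_embedding_of_comp {L : FirstOrder.Language.{u, v}} {M N P : Type*}
    [L.Structure M] [L.Structure N] [L.Structure P] (f : M →[L] N) (g : N →[L] P)
    (e : M ↪[L] P) (he : ⇑e = g ∘ f) : ∃ e' : M ↪[L] N, ⇑e' = f := by
  have hinj : Function.Injective f := Function.Injective.of_comp (he ▸ e.injective)
  refine ⟨⟨⟨f, hinj⟩, fun F x => f.map_fun F x, fun {n} R x => ⟨fun hR => ?_, f.map_rel R x⟩⟩, rfl⟩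
  have := g.map_rel R _ hR
  rw [← e.map_rel R x, he]
  exact this

/-- Any two embeddings of a finite structure into an ultrahomogeneous structure differ by an
automorphism. -/
theorem exists_automorphism_of_embeddings {L : FirstOrder.Language.{u, v}} {M : Type*} {A : Type*}
    [L.Structure M] [L.Structure A] [Finite A] (hM : L.IsUltrahomogeneous M)
    (e f : A ↪[L] M) : ∃ α : M ≃[L] M, ⇑e = α ∘ f := by
  have hfg : f.toHom.range.FG := by
    refine Substructure.fg_def.2 ⟨Set.range f, Set.finite_range f, ?_⟩
    exact Substructure.closure_eq f.toHom.range
  obtain ⟨α, hα⟩ := hM _ hfg (e.comp f.equivRange.symm.toEmbedding)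
  refine ⟨α, funext fun a => ?_⟩
  have := DFunLike.congr_fun hα (f.equivRange a)
  simpa using this

/-- A homomorphism from an ultrahomogeneous structure `Γ` to a core `Δ` that embeds into `Γ`
sends every copy in `Γ` of a finite structure from the age of `Δ` to a copy in `Δ`. -/
theorem IsCore.exists_embedding_comp {L : FirstOrder.Language.{u, v}} {Γ Δ A : Type*}
    [L.Structure Γ] [L.Structure Δ] [L.Structure A] [Finite A] (hΔ : IsCore L Δ)
    (hΓ : L.IsUltrahomogeneous Γ) (h : Γ →[L] Δ) (i : Δ ↪[L] Γ) (a : A ↪[L] Δ) (e : A ↪[L] Γ) :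
    ∃ e' : A ↪[L] Δ, ⇑e' = h ∘ e := by
  obtain ⟨α, hα⟩ := exists_automorphism_of_embeddings hΓ e (i.comp a)
  obtain ⟨k, hk⟩ := hΔ (h.comp (α.toHom.comp i.toHom))
  refine ⟨k.comp a, funext fun x => ?_⟩
  simp [hk, hα]

/-- If `Γ` is a countable ω-categorical homogeneous Ramsey structure and `Δ` is a
model-complete core (in the same relational signature) homomorphically equivalent to `Γ`,
then `Δ` is also Ramsey. -/
theorem statement9 (L : FirstOrder.Language.{u, v}) [L.IsRelational]
    (Γ : Type w) (Δ : Type w) [Countable Γ] [Countable Δ]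
    [L.Structure Γ] [L.Structure Δ]
    (hΓhom : L.IsUltrahomogeneous Γ) (hΓcat : IsOmegaCategorical L Γ)
    (hΓram : IsRamseyStructure L Γ)
    (hΔ : IsModelCompleteCore L Δ)
    (h : Nonempty (Γ →[L] Δ)) (i : Nonempty (Δ →[L] Γ)) :
    IsRamseyStructure L Δ := by
  obtain ⟨h⟩ := h
  obtain ⟨i⟩ := i
  obtain ⟨e, he⟩ := hΔ.1 (h.comp i)
  obtain ⟨j, -⟩ := exists_embedding_of_comp i h e he
  rintro A ⟨hAfin, ⟨a⟩⟩ B ⟨hBfin, ⟨b⟩⟩ r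
  obtain ⟨C, ⟨hCfin, ⟨c⟩⟩, hC⟩ := hΓram A ⟨hAfin, ⟨j.comp a⟩⟩ B ⟨hBfin, ⟨j.comp b⟩⟩ r
  let S : L.Substructure Δ := (h.comp c.toHom).range
  have lift : ∀ {X : Type w} [L.Structure X] [Finite X] (_ : X ↪[L] Δ) (f : X ↪[L] C),
      ∃ f' : X ↪[L] S, ∀ x, (f' x : Δ) = h (c (f x)) := by
    intro X _ _ d f
    obtain ⟨k, hk⟩ := hΔ.1.exists_embedding_comp hΓhom h j d (c.comp f)
    have hmem : ∀ x, k x ∈ S := fun x => ⟨f x, by simp [hk]⟩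
    exact ⟨k.codRestrict S hmem, fun x => by simp [hk]⟩
  choose F hF using fun f : A ↪[L] C => lift a f
  refine ⟨⟨S, inferInstance⟩, ⟨?_, ⟨S.subtype⟩⟩, fun χ => ?_⟩
  · exact Set.finite_range (h.comp c.toHom)
  · obtain ⟨g, hg⟩ := hC fun f => χ (F f)
    obtain ⟨g', hg'⟩ := lift b g
    refine ⟨g', fun f₁ f₂ => ?_⟩
    have key : ∀ f : A ↪[L] B, g'.comp f = F (g.comp f) := fun f =>
      Embedding.ext fun x => Subtype.ext <| by
        rw [hF]
        exact hg' (f x)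
    have := hg f₁ f₂
    simp only [← key] at this
    exact this
end

section
/- Let σ and τ be disjoint relational signatures and let Γ₁ (a σ-structure) and Γ₂ (a τ-structure) be homogeneous structures with the same domain D, each of whose signatures contains a binary relation symbol interpreted as a strict linear order on D. Then the full product Γ₁ ⊠ Γ₂ is homogeneous. -/
open FirstOrder FirstOrder.Language CategoryTheory

universe u v u' v' w w'

/-- The full product `Γ₁ ⊠ Γ₂` of a `σ`-structure and a `τ`-structure with the same domain
`D` (for disjoint relational signatures, modelled by `σ.sum τ`): the `(σ ∪ τ)`-structure on
`D × D` where a `σ`-relation holds of a tuple iff it holds of the first coordinates in `Γ₁`,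
and a `τ`-relation holds iff it holds of the second coordinates in `Γ₂`. -/
def fullProduct (σ : FirstOrder.Language.{u, v}) (τ : FirstOrder.Language.{u', v'})
    [σ.IsRelational] [τ.IsRelational] (D : Type w) [σ.Structure D] [τ.Structure D] :
    (σ.sum τ).Structure (D × D) where
  funMap := fun {_} f => isEmptyElim f
  RelMap {n} R := Sum.elim
    (fun (R' : σ.Relations n) (x : Fin n → D × D) => Structure.RelMap R' fun i => (x i).1)
    (fun (R' : τ.Relations n) (x : Fin n → D × D) => Structure.RelMap R' fun i => (x i).2) R

/-- In an ultrahomogeneous relational structure, two finite families of the same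
quantifier-free type are conjugate under an automorphism. -/
theorem exists_equiv_of_relMap_iff {L : FirstOrder.Language.{u, v}} [L.IsRelational]
    {M : Type w} [L.Structure M] (hM : L.IsUltrahomogeneous M) {ι : Type w'} [Finite ι]
    (a b : ι → M) (heq : ∀ i j, a i = a j ↔ b i = b j)
    (hrel : ∀ (n : ℕ) (R : L.Relations n) (x : Fin n → ι),
      Structure.RelMap R (fun k => b (x k)) ↔ Structure.RelMap R (fun k => a (x k))) :
    ∃ g : M ≃[L] M, ∀ i, g (a i) = b i := by
  let S : L.Substructure M := ⟨Set.range a, fun {_} f => isEmptyElim f⟩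
  have hS : S.FG := Substructure.fg_iff_finite.2 (Set.finite_range a).to_subtype
  have hmem (s : S) : ∃ i, a i = s := s.2
  choose idx hidx using hmem
  let e : S ↪[L] M :=
    { toFun := fun s => b (idx s)
      inj' := fun s t hst => Subtype.ext <| by
        rw [← hidx s, ← hidx t]
        exact (heq _ _).2 hst
      map_fun' := fun {_} f => isEmptyElim f
      map_rel' := fun {n} R x => by
        refine (hrel n R fun k => idx (x k)).trans ?_
        simp only [hidx]
        rfl }
  obtain ⟨g, hg⟩ := hM S hS e
  refine ⟨g, fun i => ?_⟩
  have hi : b (idx ⟨a i, i, rfl⟩) = g (a i) := congrArg (fun φ => φ ⟨a i, i, rfl⟩) hg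
  rw [← hi]
  exact (heq _ _).1 (hidx ⟨a i, i, rfl⟩)

/-- If moreover a binary relation of the language is a strict linear order, agreement on relations
already forces agreement on equality. -/
theorem exists_equiv_of_relMap_iff_of_isStrictTotalOrder {L : FirstOrder.Language.{u, v}}
    [L.IsRelational] {M : Type w} [L.Structure M] (hM : L.IsUltrahomogeneous M)
    (R₀ : L.Relations 2) (hR₀ : IsStrictTotalOrder M fun x y => Structure.RelMap R₀ ![x, y])
    {ι : Type w'} [Finite ι] (a b : ι → M)
    (hrel : ∀ (n : ℕ) (R : L.Relations n) (x : Fin n → ι),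
      Structure.RelMap R (fun k => b (x k)) ↔ Structure.RelMap R (fun k => a (x k))) :
    ∃ g : M ≃[L] M, ∀ i, g (a i) = b i := by
  have key (x y : M) : x = y ↔
      ¬ Structure.RelMap R₀ ![x, y] ∧ ¬ Structure.RelMap R₀ ![y, x] := by
    refine ⟨?_, fun h => hR₀.trichotomous x y h.1 h.2⟩
    rintro rfl
    exact ⟨hR₀.irrefl x, hR₀.irrefl x⟩
  have hpair (c : ι → M) (i j : ι) : (fun k => c (![i, j] k)) = ![c i, c j] := by
    ext k
    fin_cases k <;> rfl
  have hlt (i j : ι) : Structure.RelMap R₀ ![b i, b j] ↔ Structure.RelMap R₀ ![a i, a j] := by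
    simpa only [hpair] using hrel 2 R₀ ![i, j]
  exact exists_equiv_of_relMap_iff hM a b
    (fun i j => by rw [key (a i), key (b i), hlt, hlt]) hrel

/-- If `Γ₁` and `Γ₂` are ordered homogeneous structures with the same domain `D` and disjoint
relational signatures, then the full product `Γ₁ ⊠ Γ₂` is homogeneous. -/
theorem statement10 (σ : FirstOrder.Language.{u, v}) (τ : FirstOrder.Language.{u', v'})
    [σ.IsRelational] [τ.IsRelational] (D : Type w) [σ.Structure D] [τ.Structure D]
    (R₁ : σ.Relations 2)
    (hR₁ : IsStrictTotalOrder D fun x y => Structure.RelMap R₁ ![x, y])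
    (R₂ : τ.Relations 2)
    (hR₂ : IsStrictTotalOrder D fun x y => Structure.RelMap R₂ ![x, y])
    (h₁ : σ.IsUltrahomogeneous D) (h₂ : τ.IsUltrahomogeneous D) :
    @FirstOrder.Language.IsUltrahomogeneous (σ.sum τ) (D × D) (fullProduct σ τ D) := by
  letI := fullProduct σ τ D
  intro S hS f
  have hfin : Finite S := hS.finite
  obtain ⟨g₁, hg₁⟩ := exists_equiv_of_relMap_iff_of_isStrictTotalOrder h₁ R₁ hR₁
    (fun s : S => (s : D × D).1) (fun s => (f s).1) fun n R x =>
      f.map_rel (Sum.inl R : (σ.sum τ).Relations n) x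
  obtain ⟨g₂, hg₂⟩ := exists_equiv_of_relMap_iff_of_isStrictTotalOrder h₂ R₂ hR₂
    (fun s : S => (s : D × D).2) (fun s => (f s).2) fun n R x =>
      f.map_rel (Sum.inr R : (σ.sum τ).Relations n) x
  let g : (D × D) ≃[σ.sum τ] (D × D) :=
    { g₁.toEquiv.prodCongr g₂.toEquiv with
      map_fun' := fun {_} f => isEmptyElim f
      map_rel' := fun {n} R x => by
        rcases R with R | R
        · exact g₁.map_rel R fun i => (x i).1
        · exact g₂.map_rel R fun i => (x i).2 }
  refine ⟨g, ?_⟩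
  ext s : 1
  exact Prod.ext (hg₁ s).symm (hg₂ s).symm
end

section
/- Let σ and τ be disjoint relational signatures and let Γ₁ (a σ-structure) and Γ₂ (a τ-structure) be structures with the same domain D, each of whose signatures contains a binary relation symbol interpreted as a strict linear order on D. Then a bijection of D × D is an automorphism of the full product Γ₁ ⊠ Γ₂ if and only if it is of the form (x, y) ↦ (α(x), β(y)) for some automorphism α of Γ₁ and some automorphism β of Γ₂. -/
open FirstOrder FirstOrder.Language CategoryTheory

universe u v u' v' w w'

/-- If `L` has a relation symbol interpreted as a strict linear order on `D`, and `F` is a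
permutation of `E` preserving and reflecting all `L`-relations pulled back along a split
surjection `π : E → D`, then `F` descends along `π` to an automorphism of `D`. -/
theorem exists_equiv_of_pullback (L : FirstOrder.Language.{u, v}) [L.IsRelational]
    {D : Type w} [L.Structure D] (R₀ : L.Relations 2)
    (hR₀ : IsStrictTotalOrder D fun x y => Structure.RelMap R₀ ![x, y])
    {E : Type w'} (π : E → D) (s : D → E) (hs : Function.RightInverse s π) (F : E ≃ E)
    (hF : ∀ (n : ℕ) (R : L.Relations n) (x : Fin n → E),
      Structure.RelMap R (fun i => π (F (x i))) ↔ Structure.RelMap R fun i => π (x i)) :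
    ∃ α : D ≃[L] D, ∀ p, π (F p) = α (π p) := by
  have hlt (p q : E) :
      Structure.RelMap R₀ ![π (F p), π (F q)] ↔ Structure.RelMap R₀ ![π p, π q] := by
    convert hF 2 R₀ ![p, q] using 2 <;> ext i <;> fin_cases i <;> rfl
  have eq_iff (a b : D) :
      a = b ↔ ¬ Structure.RelMap R₀ ![a, b] ∧ ¬ Structure.RelMap R₀ ![b, a] := by
    constructor
    · rintro rfl
      exact ⟨hR₀.irrefl a, hR₀.irrefl a⟩
    · rintro ⟨h₁, h₂⟩
      exact hR₀.trichotomous a b h₁ h₂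
  have heq (p q : E) : π (F p) = π (F q) ↔ π p = π q := by
    rw [eq_iff, eq_iff (π p), hlt, hlt]
  have hbij : Function.Bijective fun x => π (F (s x)) := by
    refine ⟨fun x y h => ?_, fun z => ⟨π (F.symm (s z)), ?_⟩⟩
    · simpa only [hs x, hs y] using (heq _ _).1 h
    · calc
        π (F (s (π (F.symm (s z))))) = π (F (F.symm (s z))) := (heq _ _).2 (hs _)
        _ = z := by rw [F.apply_symm_apply, hs z]
  refine ⟨⟨Equiv.ofBijective _ hbij, fun f => isEmptyElim f, fun {n} R x => ?_⟩,
    fun p => (heq _ _).2 (hs _).symm⟩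
  have h := hF n R fun i => s (x i)
  simp only [hs _] at h
  exact h

/-- For ordered structures `Γ₁`, `Γ₂` on the same domain `D` with disjoint relational
signatures, a bijection of `D × D` is an automorphism of the full product `Γ₁ ⊠ Γ₂` if and
only if it is of the form `(x, y) ↦ (α x, β y)` for automorphisms `α` of `Γ₁` and `β` of
`Γ₂`. -/
theorem statement12 (σ : FirstOrder.Language.{u, v}) (τ : FirstOrder.Language.{u', v'})
    [σ.IsRelational] [τ.IsRelational] (D : Type w) [σ.Structure D] [τ.Structure D]
    (R₁ : σ.Relations 2)
    (hR₁ : IsStrictTotalOrder D fun x y => Structure.RelMap R₁ ![x, y])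
    (R₂ : τ.Relations 2)
    (hR₂ : IsStrictTotalOrder D fun x y => Structure.RelMap R₂ ![x, y]) :
    ∀ F : (D × D) ≃ (D × D),
      (∃ F' : @FirstOrder.Language.Equiv (σ.sum τ) (D × D) (D × D)
          (fullProduct σ τ D) (fullProduct σ τ D), ⇑F' = ⇑F) ↔
        ∃ (α : D ≃[σ] D) (β : D ≃[τ] D), ∀ p : D × D, F p = (α p.1, β p.2) := by
  intro F
  let := fullProduct σ τ D
  constructor
  · rintro ⟨F', hF'⟩
    obtain ⟨α, hα⟩ := exists_equiv_of_pullback σ R₁ hR₁ Prod.fst (fun x => (x, x))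
      (fun _ => rfl) F fun n R x => by
        rw [← hF']
        exact F'.map_rel' (Sum.inl R) x
    obtain ⟨β, hβ⟩ := exists_equiv_of_pullback τ R₂ hR₂ Prod.snd (fun x => (x, x))
      (fun _ => rfl) F fun n R x => by
        rw [← hF']
        exact F'.map_rel' (Sum.inr R) x
    exact ⟨α, β, fun p => Prod.ext (hα p) (hβ p)⟩
  · rintro ⟨α, β, hF⟩
    refine ⟨⟨F, fun f => isEmptyElim f, fun {n} R x => ?_⟩, rfl⟩
    have hFx : ⇑F ∘ x = fun i => (α (x i).1, β (x i).2) := funext fun i => hF (x i)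
    change Structure.RelMap R (⇑F ∘ x) ↔ _
    rw [hFx]
    rcases R with R | R
    · exact α.map_rel R fun i => (x i).1
    · exact β.map_rel R fun i => (x i).2
end

section
/- Let τ be a relational signature and let Γ be a countable homogeneous τ-structure such that the class of all finite τ-structures that embed into Γ has the strong amalgamation property, and such that every relation of Γ is injective (contains only tuples with pairwise distinct entries). Then every finite τ-structure F that admits a homomorphism to Γ also admits an injective homomorphism to Γ. -/
open FirstOrder FirstOrder.Language CategoryTheory

universe u v u' v' w w'

/-- A class of structures has the strong amalgamation property if every amalgamation diagram
has a strong amalgam in the class. -/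
def StrongAmalgamationProperty {L : FirstOrder.Language.{u, v}}
    (K : Set (Bundled.{w} L.Structure)) : Prop :=
  ∀ A ∈ K, ∀ B₁ ∈ K, ∀ B₂ ∈ K, ∀ e₁ : A ↪[L] B₁, ∀ e₂ : A ↪[L] B₂,
    ∃ C ∈ K, ∃ f₁ : B₁ ↪[L] C, ∃ f₂ : B₂ ↪[L] C,
      f₁.comp e₁ = f₂.comp e₂ ∧
      Set.range ⇑f₁ ∩ Set.range ⇑f₂ = Set.range ⇑(f₁.comp e₁)

/-- In an ultrahomogeneous structure whose age has the strong amalgamation property, a finite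
set `S` containing `a` can be re-embedded so that all elements of `S` other than `a` are fixed
and `a` is moved outside `S`. -/
theorem exists_embedding_fixing_moving_outside {L : FirstOrder.Language.{u, v}} [L.IsRelational]
    {Γ : Type w} [L.Structure Γ] (hhom : L.IsUltrahomogeneous Γ)
    (hsap : StrongAmalgamationProperty (Age L Γ)) {S : Set Γ} (hS : S.Finite) (a : Γ) :
    ∃ j : Substructure.closure L S ↪[L] Γ,
      ∀ b : Substructure.closure L S, ((b : Γ) ≠ a → j b = b) ∧ ((b : Γ) = a → j b ∉ S) := by
  have mem (T : Set Γ) (x : Γ) : x ∈ Substructure.closure L T ↔ x ∈ T :=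
    Substructure.mem_closure_iff_of_isRelational L T x
  have mem_age {T : Set Γ} (hT : T.Finite) :
      (Bundled.of (Substructure.closure L T) : Bundled L.Structure) ∈ Age L Γ := by
    refine ⟨?_, ⟨(Substructure.closure L T).subtype⟩⟩
    exact (Substructure.fg_closure hT).finite
  have hle : Substructure.closure L (S \ {a}) ≤ Substructure.closure L S :=
    Substructure.closure_mono Set.sdiff_subset
  obtain ⟨C, ⟨-, ⟨g⟩⟩, f₁, f₂, hcomp, hrange⟩ :=
    hsap _ (mem_age hS.sdiff) _ (mem_age hS) _ (mem_age hS)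
      (Substructure.inclusion hle) (Substructure.inclusion hle)
  obtain ⟨σ, hσ⟩ := hhom _ (Substructure.fg_closure hS) (g.comp f₁)
  have hσ' (b : Substructure.closure L S) : σ.symm (g (f₁ b)) = b := by
    have := DFunLike.congr_fun hσ b
    change g (f₁ b) = σ b at this
    rw [this, σ.symm_apply_apply]
  refine ⟨σ.symm.toEmbedding.comp (g.comp f₂), fun b => ⟨fun hb => ?_, fun hb hmem => ?_⟩⟩
  · have hbA : (b : Γ) ∈ Substructure.closure L (S \ {a}) :=
      (mem _ _).2 ⟨(mem _ _).1 b.2, hb⟩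
    have h₁₂ : f₁ b = f₂ b := DFunLike.congr_fun hcomp ⟨b, hbA⟩
    change σ.symm (g (f₂ b)) = b
    rw [← h₁₂, hσ']
  · change σ.symm (g (f₂ b)) ∈ S at hmem
    have heq := hσ' ⟨_, (mem _ _).2 hmem⟩
    have h₁₂ := g.injective (σ.symm.injective heq)
    have hb₂ : f₂ b ∈ Set.range f₁ ∩ Set.range f₂ := ⟨⟨_, h₁₂⟩, ⟨b, rfl⟩⟩
    rw [hrange, hcomp] at hb₂
    obtain ⟨c, hc⟩ := hb₂
    have hcb : c.1 = (b : Γ) := congrArg Subtype.val (f₂.injective hc)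
    exact ((mem _ _).1 c.2).2 (hcb.trans hb)

/-- A homomorphism from a finite structure into a structure with injective relations that
identifies two points can be modified to have a strictly larger image. -/
theorem exists_hom_range_ssubset {L : FirstOrder.Language.{u, v}} [L.IsRelational]
    {Γ : Type w} [L.Structure Γ] (hhom : L.IsUltrahomogeneous Γ)
    (hsap : StrongAmalgamationProperty (Age L Γ))
    (hinj : ∀ (n : ℕ) (R : L.Relations n) (t : Fin n → Γ),
      Structure.RelMap R t → Function.Injective t)
    {F : Type w'} [L.Structure F] [Finite F] (h : F →[L] Γ) (hh : ¬ Function.Injective h) :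
    ∃ h' : F →[L] Γ, Set.range h ⊂ Set.range h' := by
  classical
  obtain ⟨x, y, hxy, hne⟩ := Function.not_injective_iff.1 hh
  obtain ⟨j, hj⟩ :=
    exists_embedding_fixing_moving_outside hhom hsap (Set.finite_range h) (h x)
  let k (u : F) : Substructure.closure L (Set.range h) :=
    ⟨h u, Substructure.subset_closure ⟨u, rfl⟩⟩
  let h' : F →[L] Γ :=
    { toFun := Function.update h x (j (k x))
      map_fun' := fun f => isEmptyElim f
      map_rel' := fun {n} R t ht => by
        have hR := h.map_rel R t ht
        by_cases hx : ∃ i, t i = x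
        · obtain ⟨i, hi⟩ := hx
          have heq : Function.update h x (j (k x)) ∘ t = j ∘ k ∘ t := by
            funext l
            by_cases hl : t l = x
            · simp [hl]
            · have hne' : h (t l) ≠ h x := fun hlx => hl <| by
                have : l = i := hinj n R _ hR (by simp [hi, hlx])
                rw [this, hi]
              simpa [hl] using ((hj (k (t l))).1 hne').symm
          rw [heq, j.map_rel]
          exact hR
        · have heq : Function.update h x (j (k x)) ∘ t = h ∘ t := by
            funext l
            have hl : t l ≠ x := fun hl => hx ⟨l, hl⟩
            simp [hl]
          rwa [heq] }
  have hx' : h' x = j (k x) := Function.update_self x (j (k x)) h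
  have h_off {u : F} (hu : u ≠ x) : h' u = h u := Function.update_of_ne hu (j (k x)) h
  refine ⟨h', (Set.ssubset_iff_of_subset ?_).2
    ⟨h' x, ⟨x, rfl⟩, hx' ▸ (hj (k x)).2 rfl⟩⟩
  rintro _ ⟨u, rfl⟩
  by_cases hu : u = x
  · exact ⟨y, by rw [h_off hne.symm, hu, hxy]⟩
  · exact ⟨u, h_off hu⟩

/-- If `Γ` is a countable homogeneous structure whose age has the strong amalgamation
property and all of whose relations are injective (contain only tuples with pairwise distinct
entries), then every finite structure that homomorphically maps to `Γ` also has an injective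
homomorphism to `Γ`. -/
theorem statement13 (L : FirstOrder.Language.{u, v}) [L.IsRelational]
    (Γ : Type w) [Countable Γ] [L.Structure Γ]
    (hhom : L.IsUltrahomogeneous Γ)
    (hsap : StrongAmalgamationProperty (Age L Γ))
    (hinj : ∀ (n : ℕ) (R : L.Relations n) (t : Fin n → Γ),
      Structure.RelMap R t → Function.Injective t)
    (F : Type w) [L.Structure F] [Finite F] (hF : Nonempty (F →[L] Γ)) :
    ∃ h : F →[L] Γ, Function.Injective ⇑h := by
  by_contra! hno
  have hlarge (n : ℕ) : ∃ h : F →[L] Γ, n ≤ (Set.range h).ncard := by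
    induction n with
    | zero => exact ⟨hF.some, Nat.zero_le _⟩
    | succ n ih =>
      obtain ⟨h, hn⟩ := ih
      obtain ⟨h', hlt⟩ := exists_hom_range_ssubset hhom hsap hinj h (hno h)
      exact ⟨h', hn.trans_lt (Set.ncard_lt_ncard hlt (Set.finite_range h'))⟩
  obtain ⟨h, hn⟩ := hlarge (Nat.card F + 1)
  have hle : (Set.range h).ncard ≤ Nat.card F := Finite.card_range_le h
  omega
end

section
/- Let σ and τ be disjoint relational signatures and let Γ be a homogeneous (σ ∪ τ)-structure whose σ-reduct and τ-reduct are both cores. Then Γ is a model-complete core: every endomorphism of Γ is an embedding, and for every self-embedding e of Γ and every finite tuple t of elements of Γ there is an automorphism α of Γ with e(t) = α(t). -/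
open FirstOrder FirstOrder.Language CategoryTheory

universe u v u' v' w w'

/-- If `Γ` is a homogeneous structure in a signature `σ ∪ τ` (for disjoint relational
signatures `σ` and `τ`) whose `σ`-reduct and `τ`-reduct are both cores, then `Γ` is a
model-complete core. -/
theorem statement15 (σ : FirstOrder.Language.{u, v}) (τ : FirstOrder.Language.{u', v'})
    [σ.IsRelational] [τ.IsRelational] (D : Type w) [(σ.sum τ).Structure D]
    (hhom : (σ.sum τ).IsUltrahomogeneous D)
    (hcore₁ : @IsCore σ D ((LHom.sumInl : σ →ᴸ σ.sum τ).reduct D))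
    (hcore₂ : @IsCore τ D ((LHom.sumInr : τ →ᴸ σ.sum τ).reduct D)) :
    IsModelCompleteCore (σ.sum τ) D := by
  refine ⟨fun h => ?_, fun e n t => ?_⟩
  · let _ : σ.Structure D := (LHom.sumInl : σ →ᴸ σ.sum τ).reduct D
    let _ : τ.Structure D := (LHom.sumInr : τ →ᴸ σ.sum τ).reduct D
    obtain ⟨e₁, he₁⟩ := hcore₁ ⟨h, fun f => isEmptyElim f, fun r x => h.map_rel (Sum.inl r) x⟩
    obtain ⟨e₂, he₂⟩ := hcore₂ ⟨h, fun f => isEmptyElim f, fun r x => h.map_rel (Sum.inr r) x⟩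
    replace he₁ : ⇑e₁ = ⇑h := he₁
    replace he₂ : ⇑e₂ = ⇑h := he₂
    refine ⟨⟨⟨h, he₁ ▸ e₁.injective⟩, fun f => h.map_fun f, ?_⟩, rfl⟩
    rintro n (r | r) x
    · have hr := e₁.map_rel r x
      rw [he₁] at hr
      exact hr
    · have hr := e₂.map_rel r x
      rw [he₂] at hr
      exact hr
  · obtain ⟨g, hg⟩ := hhom (Substructure.closure _ (Set.range t))
      (Substructure.fg_closure (Set.finite_range t)) (e.comp (Substructure.subtype _))
    exact ⟨g, fun i => DFunLike.congr_fun hg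
      ⟨t i, Substructure.subset_closure (Set.mem_range_self i)⟩⟩
end

section
/- The class of all finite structures (X, <, E, T), where < is a strict linear order, E is a graph relation (symmetric and irreflexive), and T is a tournament relation (for all distinct x, y exactly one of T(x,y), T(y,x) holds, and never T(x,x)), has the Ramsey property: for all A, B in this class and all r ∈ ℕ there exists C in this class such that for every coloring χ : Emb(A,C) → Fin r there is g ∈ Emb(B,C) with χ constant on {g ∘ f : f ∈ Emb(A,B)}. -/
/-- **Finite Ramsey theorem** for `a`-element subsets of a linear order. -/
theorem exists_monochromatic_finset {V κ : Type} [LinearOrder V] [Finite κ] (a b : ℕ) :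
    ∃ N : ℕ, ∀ (χ : Finset V → κ) (S : Finset V), N ≤ S.card →
      ∃ W ⊆ S, W.card = b ∧ ∃ c, ∀ F ⊆ W, F.card = a → χ F = c := by
  classical
  induction a generalizing b with
  | zero =>
    refine ⟨b, fun χ S hS => ?_⟩
    obtain ⟨W, hW, hc⟩ := Finset.exists_subset_card_eq hS
    refine ⟨W, hW, hc, χ ∅, fun F _ hF => ?_⟩
    rw [Finset.card_eq_zero.mp hF]
  | succ a ih =>
    have end_homogeneous : ∀ m : ℕ, ∃ N : ℕ, ∀ (χ : Finset V → κ) (S : Finset V),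
        N ≤ S.card → ∃ W ⊆ S, W.card = m ∧ ∃ c : V → κ,
          ∀ F ⊆ W, F.card = a + 1 → ∀ h : F.Nonempty, χ F = c (F.min' h) := by
      intro m
      induction m with
      | zero =>
        refine ⟨0, fun χ S _ => ⟨∅, Finset.empty_subset _, rfl, fun _ => χ ∅, ?_⟩⟩
        intro F hF _ h
        exact absurd (Finset.subset_empty.mp hF) h.ne_empty
      | succ m ihm =>
        obtain ⟨M, hM⟩ := ihm
        obtain ⟨N, hN⟩ := ih M
        refine ⟨N + 1, fun χ S hS => ?_⟩
        have hne : S.Nonempty := Finset.card_pos.mp (by omega)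
        set v := S.min' hne with hv
        have hvS : v ∈ S := Finset.min'_mem _ _
        obtain ⟨W₀, hW₀, hc₀, k, hk⟩ := hN (fun F => χ (insert v F)) (S.erase v)
          (by rw [Finset.card_erase_of_mem hvS]; omega)
        obtain ⟨W, hW, hc, c, hcW⟩ := hM χ W₀ hc₀.ge
        have hlt : ∀ x ∈ W, v < x := fun x hx =>
          lt_of_le_of_ne (Finset.min'_le _ _ (Finset.mem_of_mem_erase (hW₀ (hW hx))))
            (Finset.ne_of_mem_erase (hW₀ (hW hx))).symm
        have hvW : v ∉ W := fun h => lt_irrefl _ (hlt v h)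
        refine ⟨insert v W, ?_, by rw [Finset.card_insert_of_notMem hvW, hc],
          Function.update c v k, fun F hF hFc h => ?_⟩
        · exact Finset.insert_subset hvS
            ((hW.trans hW₀).trans (Finset.erase_subset _ _))
        · by_cases hvF : v ∈ F
          · have hmin : F.min' h = v := by
              refine le_antisymm (Finset.min'_le _ _ hvF) (Finset.le_min' _ _ _ fun y hy => ?_)
              rcases Finset.mem_insert.mp (hF hy) with rfl | hy
              · exact le_rfl
              · exact (hlt y hy).le
            have := hk (F.erase v)
              (fun x hx => hW ((Finset.mem_insert.mp (hF (Finset.mem_of_mem_erase hx))).resolve_left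
                (Finset.ne_of_mem_erase hx)))
              (by rw [Finset.card_erase_of_mem hvF]; omega)
            rw [hmin, Function.update_self, ← this, Finset.insert_erase hvF]
          · have hFW : F ⊆ W := (Finset.subset_insert_iff_of_notMem hvF).mp hF
            have hmin : F.min' h ≠ v := fun e => hvF (e ▸ Finset.min'_mem F h)
            rw [Function.update_of_ne hmin]
            exact hcW F hFW hFc h
    have := Fintype.ofFinite κ
    obtain ⟨N, hN⟩ := end_homogeneous (Fintype.card κ * b)
    refine ⟨N, fun χ S hS => ?_⟩
    have : Nonempty κ := ⟨χ ∅⟩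
    obtain ⟨W, hW, hc, c, hcW⟩ := hN χ S hS
    obtain ⟨k, -, hk⟩ := Finset.exists_le_card_fiber_of_mul_le_card_of_maps_to
      (s := W) (t := Finset.univ) (f := c) (n := b) (fun _ _ => Finset.mem_univ _)
      Finset.univ_nonempty (by rw [hc, Finset.card_univ])
    obtain ⟨U, hU, hUc⟩ := Finset.exists_subset_card_eq hk
    refine ⟨U, hU.trans ((Finset.filter_subset _ _).trans hW), hUc, k, fun F hF hFc => ?_⟩
    have hne : F.Nonempty := Finset.card_pos.mp (by omega)
    rw [hcW F (hF.trans (hU.trans (Finset.filter_subset _ _))) hFc hne]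
    exact (Finset.mem_filter.mp (hU (hF (Finset.min'_mem F hne)))).2

/-- The Ramsey property of the class of finite linear orders. -/
theorem exists_monochromatic_orderEmbedding (α β κ : Type) [LinearOrder α] [Finite α]
    [LinearOrder β] [Finite β] [Finite κ] :
    ∃ N : ℕ, ∀ χ : (α ↪o Fin N) → κ, ∃ g : β ↪o Fin N,
      ∀ f₁ f₂ : α ↪o β, χ (f₁.trans g) = χ (f₂.trans g) := by
  classical
  have := Fintype.ofFinite α
  have := Fintype.ofFinite β
  obtain ⟨N, hN⟩ := exists_monochromatic_finset (V := ℕ) (κ := Option κ)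
    (Fintype.card α) (Fintype.card β)
  refine ⟨N, fun χ => ?_⟩
  let img : (α ↪o Fin N) → Finset ℕ := fun f => Finset.univ.image fun x => (f x : ℕ)
  have img_inj : Function.Injective img := by
    intro f f' h
    have hr : Set.range (fun x => (f x : ℕ)) = Set.range (fun x => (f' x : ℕ)) := by
      have := congrArg (fun s : Finset ℕ => (s : Set ℕ)) h
      simpa [img] using this
    have := (StrictMono.range_inj (f := fun x => (f x : ℕ)) (g := fun x => (f' x : ℕ))
      (fun x y hxy => f.strictMono hxy) (fun x y hxy => f'.strictMono hxy)).mp hr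
    ext x
    exact congrFun this x
  obtain ⟨W, hW, hWc, c, hc⟩ := hN
    (fun F => if h : ∃ f, img f = F then some (χ h.choose) else none) (Finset.range N)
    (by simp)
  let e : β ↪o W := ((Fintype.orderIsoFinOfCardEq β rfl).symm.trans
    (W.orderIsoOfFin hWc)).toOrderEmbedding
  have hlt : ∀ x, (e x : ℕ) < N := fun x => Finset.mem_range.mp (hW (e x).2)
  let g : β ↪o Fin N := OrderEmbedding.ofStrictMono (fun x => ⟨e x, hlt x⟩)
    fun x y hxy => e.strictMono hxy
  have key : ∀ f : α ↪o β, some (χ (f.trans g)) = c := by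
    intro f
    have hex : ∃ f', img f' = img (f.trans g) := ⟨_, rfl⟩
    have := hc (img (f.trans g)) ?_ ?_
    · rw [dif_pos hex, img_inj hex.choose_spec] at this
      exact this
    · intro n hn
      obtain ⟨x, -, rfl⟩ := Finset.mem_image.mp hn
      exact (e (f x)).2
    · exact Finset.card_image_of_injective _ (Fin.val_injective.comp (f.trans g).injective)
  exact ⟨g, fun f₁ f₂ => Option.some_injective _ ((key f₁).trans (key f₂).symm)⟩

/-- A finite set of vertices partitioned into parts indexed by `J`, with a label in `K` on each
pair of vertices; only labels of pairs in increasing distinct parts are relevant. -/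
structure PartiteSystem (J K : Type) : Type 1 where
  vertex : Type
  finite : Finite vertex
  part : vertex → J
  label : vertex → vertex → K

namespace PartiteSystem

variable {J K α κ : Type} [LinearOrder J] [LinearOrder α]

/-- A map of partite systems preserving the parts and the relevant labels. -/
structure Hom (P Q : PartiteSystem J K) : Type where
  toFun : P.vertex → Q.vertex
  part_eq : ∀ x, Q.part (toFun x) = P.part x
  label_eq : ∀ x y, P.part x < P.part y → Q.label (toFun x) (toFun y) = P.label x y

/-- `f` is a copy in `P`, lying over `s`, of the linear order `α` with labels `lab`. -/
def IsCopy (P : PartiteSystem J K) (lab : α → α → K) (s : α ↪o J) (f : α → P.vertex) : Prop :=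
  (∀ i, P.part (f i) = s i) ∧ ∀ i k, i < k → P.label (f i) (f k) = lab i k

theorem IsCopy.comp {P Q : PartiteSystem J K} {lab : α → α → K} {s : α ↪o J}
    {f : α → P.vertex} (hf : P.IsCopy lab s f) (φ : Hom P Q) :
    Q.IsCopy lab s (φ.toFun ∘ f) := by
  refine ⟨fun i => (φ.part_eq _).trans (hf.1 i), fun i k hik => ?_⟩
  refine (φ.label_eq _ _ ?_).trans (hf.2 i k hik)
  rw [hf.1, hf.1]
  exact s.strictMono hik

open Classical in
/-- The power of `P` used to make copies of `lab` over `s` monochromatic. The parts met by `s` are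
replaced by powers of themselves, the other vertices remember a coordinate in `ι`. -/
noncomputable def power (P : PartiteSystem J K) (lab : α → α → K) (s : α ↪o J) (ι : Type)
    [Finite ι] [Finite α] [Finite J] : PartiteSystem J K where
  vertex := (ι → P.vertex) × (α ⊕ J × ι)
  finite := by
    have := P.finite
    infer_instance
  part x := x.2.elim s Prod.fst
  label
    | (u, .inl a), (v, .inl b) =>
      if h : ∃ j, P.label (u j) (v j) ≠ lab a b then P.label (u h.choose) (v h.choose)
      else lab a b
    | (u, .inr (_, j)), (v, _) => P.label (u j) (v j)
    | (u, .inl _), (v, .inr (_, j)) => P.label (u j) (v j)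

/-- The partite lemma: copies over one fixed sequence of parts can be made monochromatic. -/
theorem exists_monochromatic_over [Finite J] [Finite α] [Finite κ] (P : PartiteSystem J K)
    (lab : α → α → K) (s : α ↪o J) :
    ∃ Q : PartiteSystem J K, ∀ χ : (α → Q.vertex) → κ, ∃ φ : Hom P Q,
      ∀ f₁ f₂, P.IsCopy lab s f₁ → P.IsCopy lab s f₂ →
        χ (φ.toFun ∘ f₁) = χ (φ.toFun ∘ f₂) := by
  classical
  have := P.finite
  obtain ⟨ι, hι, hHJ⟩ :=
    Combinatorics.Line.exists_mono_in_high_dimension {f : α → P.vertex // P.IsCopy lab s f} κ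
  refine ⟨P.power lab s ι, fun χ => ?_⟩
  obtain ⟨L, c, hL⟩ := hHJ fun w => χ fun a => (fun j => (w j).1 a, Sum.inl a)
  obtain ⟨j₀, hj₀⟩ := L.proper
  let pt : P.vertex → α → ι → P.vertex := fun x a j => (L.idxFun j).elim x fun e => e.1 a
  let φ : P.vertex → (P.power lab s ι).vertex := fun x =>
    if h : ∃ a, s a = P.part x then (pt x h.choose, Sum.inl h.choose)
    else (fun _ => x, Sum.inr (P.part x, j₀))
  have φ_pos : ∀ x a, s a = P.part x → φ x = (pt x a, Sum.inl a) := by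
    intro x a ha
    have h : ∃ a, s a = P.part x := ⟨a, ha⟩
    have : h.choose = a := s.injective (h.choose_spec.trans ha.symm)
    simp only [φ, this]
    exact dif_pos h
  have φ_neg : ∀ x, (¬ ∃ a, s a = P.part x) → φ x = (fun _ => x, Sum.inr (P.part x, j₀)) :=
    fun x h => dif_neg h
  have pt_j₀ : ∀ x a, pt x a j₀ = x := fun x a => by simp [pt, hj₀]
  refine ⟨⟨φ, fun x => ?_, fun x y hxy => ?_⟩, ?_⟩
  · by_cases h : ∃ a, s a = P.part x
    · obtain ⟨a, ha⟩ := h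
      rw [φ_pos x a ha]
      exact ha
    · rw [φ_neg x h]
      rfl
  · by_cases hx : ∃ a, s a = P.part x
    · obtain ⟨a, ha⟩ := hx
      rw [φ_pos x a ha]
      by_cases hy : ∃ b, s b = P.part y
      · obtain ⟨b, hb⟩ := hy
        rw [φ_pos y b hb]
        have hab : a < b := by rwa [← ha, ← hb, s.lt_iff_lt] at hxy
        have hpt : ∀ j, P.label (pt x a j) (pt y b j) ≠ lab a b →
            P.label (pt x a j) (pt y b j) = P.label x y := by
          intro j hj
          cases hi : L.idxFun j with
          | none => simp [pt, hi]
          | some e => exact absurd (by simpa [pt, hi] using e.2.2 a b hab) hj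
        simp only [power]
        split_ifs with h
        · exact hpt _ h.choose_spec
        · push Not at h
          rw [← h j₀, pt_j₀, pt_j₀]
      · rw [φ_neg y hy]
        simp only [power, pt_j₀]
    · rw [φ_neg x hx]
      by_cases hy : ∃ b, s b = P.part y
      · obtain ⟨b, hb⟩ := hy
        rw [φ_pos y b hb]
        simp only [power, pt_j₀]
      · rw [φ_neg y hy]
        simp only [power]
  · have key : ∀ f, P.IsCopy lab s f → χ (φ ∘ f) = c := by
      intro f hf
      rw [← hL ⟨f, hf⟩]
      congr 1
      funext a
      rw [Function.comp_apply, φ_pos (f a) a (hf.1 a).symm]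
      congr 1
      funext j
      cases hi : L.idxFun j <;> simp [pt, hi]
    exact fun f₁ f₂ h₁ h₂ => (key f₁ h₁).trans (key f₂ h₂).symm

/-- The partite construction: the colour of a copy can be made to depend only on its parts. -/
theorem exists_color_depends_on_parts [Finite J] [Finite α] [Finite κ] (P : PartiteSystem J K)
    (lab : α → α → K) :
    ∃ Q : PartiteSystem J K, ∀ χ : (α → Q.vertex) → κ, ∃ φ : Hom P Q,
      ∀ s f₁ f₂, P.IsCopy lab s f₁ → P.IsCopy lab s f₂ →
        χ (φ.toFun ∘ f₁) = χ (φ.toFun ∘ f₂) := by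
  classical
  have : Finite (α ↪o J) := DFunLike.finite _
  have := Fintype.ofFinite (α ↪o J)
  suffices h : ∀ T : Finset (α ↪o J), ∃ Q : PartiteSystem J K, ∀ χ : (α → Q.vertex) → κ,
      ∃ φ : Hom P Q, ∀ s ∈ T, ∀ f₁ f₂, P.IsCopy lab s f₁ → P.IsCopy lab s f₂ →
        χ (φ.toFun ∘ f₁) = χ (φ.toFun ∘ f₂) by
    simpa using h Finset.univ
  intro T
  induction T using Finset.induction_on with
  | empty => exact ⟨P, fun _ => ⟨⟨id, fun _ => rfl, fun _ _ _ => rfl⟩, by simp⟩⟩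
  | insert s T _ ih =>
    obtain ⟨Q, hQ⟩ := ih
    obtain ⟨R, hR⟩ := exists_monochromatic_over (κ := κ) Q lab s
    refine ⟨R, fun χ => ?_⟩
    obtain ⟨ψ, hψ⟩ := hR χ
    obtain ⟨φ, hφ⟩ := hQ fun f => χ (ψ.toFun ∘ f)
    refine ⟨⟨ψ.toFun ∘ φ.toFun, fun x => (ψ.part_eq _).trans (φ.part_eq _),
      fun x y hxy => ?_⟩, fun t ht f₁ f₂ h₁ h₂ => ?_⟩
    · refine (ψ.label_eq _ _ ?_).trans (φ.label_eq _ _ hxy)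
      rwa [φ.part_eq, φ.part_eq]
    · rcases Finset.mem_insert.mp ht with rfl | ht
      · exact hψ _ _ (h₁.comp φ) (h₂.comp φ)
      · exact hφ t ht f₁ f₂ h₁ h₂

/-- The Ramsey property of finite linear orders with labelled pairs, with copies of `α` and `β`
taken transversal to the parts of a partite system. -/
theorem exists_monochromatic {β : Type} [LinearOrder β] [Finite α] [Finite β] [Finite κ]
    (labA : α → α → K) (labB : β → β → K) :
    ∃ (N : ℕ) (Q : PartiteSystem (Fin N) K), ∀ χ : (α → Q.vertex) → κ,
      ∃ (s : β ↪o Fin N) (g : β → Q.vertex), Q.IsCopy labB s g ∧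
        ∀ f₁ f₂ : α ↪o β, (∀ i k, i < k → labB (f₁ i) (f₁ k) = labA i k) →
          (∀ i k, i < k → labB (f₂ i) (f₂ k) = labA i k) → χ (g ∘ f₁) = χ (g ∘ f₂) := by
  classical
  obtain ⟨N, hN⟩ := exists_monochromatic_orderEmbedding α β (Option κ)
  have : Finite (β ↪o Fin N) := DFunLike.finite _
  let P : PartiteSystem (Fin N) K :=
    { vertex := (β ↪o Fin N) × β
      finite := inferInstance
      part := fun x => x.1 x.2
      label := fun x y => labB x.2 y.2 }
  obtain ⟨Q, hQ⟩ := exists_color_depends_on_parts (κ := κ) P labA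
  refine ⟨N, Q, fun χ => ?_⟩
  obtain ⟨φ, hφ⟩ := hQ χ
  obtain ⟨s, hs⟩ := hN fun t =>
    if h : ∃ f, P.IsCopy labA t f then some (χ (φ.toFun ∘ h.choose)) else none
  have hcopy : P.IsCopy labB s fun i => (s, i) := ⟨fun _ => rfl, fun _ _ _ => rfl⟩
  refine ⟨s, φ.toFun ∘ fun i => (s, i), hcopy.comp φ, fun f₁ f₂ h₁ h₂ => ?_⟩
  have key : ∀ f : α ↪o β, (∀ i k, i < k → labB (f i) (f k) = labA i k) →
      (if h : ∃ f', P.IsCopy labA (f.trans s) f' then some (χ (φ.toFun ∘ h.choose)) else none)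
        = some (χ ((φ.toFun ∘ fun i => (s, i)) ∘ f)) := by
    intro f hf
    have hc : P.IsCopy labA (f.trans s) fun i => (s, f i) := ⟨fun _ => rfl, hf⟩
    have hex : ∃ f', P.IsCopy labA (f.trans s) f' := ⟨_, hc⟩
    rw [dif_pos hex]
    exact congrArg some (hφ _ _ _ hex.choose_spec hc)
  have := hs f₁ f₂
  rw [key f₁ h₁, key f₂ h₂] at this
  exact Option.some_injective _ this

end PartiteSystem

/-- The ordered graph with a tournament in which, for `x < y`, the label of `(x, y)` tells whether
the relations with indices 1 and 2 hold. -/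
def BinStr.ofLabel {X : Type} [LT X] (l : X → X → Prop × Prop) : BinStr (Fin 3) where
  carrier := X
  rel
    | 0, x, y => x < y
    | 1, x, y => (x < y ∧ (l x y).1) ∨ (y < x ∧ (l y x).1)
    | 2, x, y => (x < y ∧ (l x y).2) ∨ (y < x ∧ ¬ (l y x).2)

/-- The class of all finite structures `(X, <, E, T)`, where `<` (index 0) is a strict linear
order, `E` (index 1) is a graph relation (symmetric and irreflexive), and `T` (index 2) is a
tournament relation (never `T x x`, and for distinct `x, y` exactly one of `T x y`, `T y x`
holds), has the Ramsey property. -/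
theorem statement17 :
    BinRamseyClass {A : BinStr (Fin 3) |
      Finite A.carrier ∧
        IsStrictTotalOrder A.carrier (A.rel 0) ∧
        (∀ x y : A.carrier, A.rel 1 x y → A.rel 1 y x) ∧
        (∀ x : A.carrier, ¬ A.rel 1 x x) ∧
        (∀ x : A.carrier, ¬ A.rel 2 x x) ∧
        (∀ x y : A.carrier, x ≠ y → (A.rel 2 x y ↔ ¬ A.rel 2 y x))} := by
  classical
  rintro A ⟨hAf, hAo, -⟩ B ⟨hBf, hBo, hBs, hBi, hBt, hBT⟩ r
  let : LinearOrder A.carrier := linearOrderOfSTO (A.rel 0)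
  let : LinearOrder B.carrier := linearOrderOfSTO (B.rel 0)
  obtain ⟨N, Q, hQ⟩ := PartiteSystem.exists_monochromatic (κ := Option (Fin r))
    (fun x y : A.carrier => (A.rel 1 x y, A.rel 2 x y))
    (fun x y : B.carrier => (B.rel 1 x y, B.rel 2 x y))
  have := Q.finite
  obtain ⟨n, ⟨e⟩⟩ := Finite.exists_equiv_fin Q.vertex
  let : LinearOrder Q.vertex := LinearOrder.lift' (fun x => toLex (Q.part x, e x))
    fun x y h => e.injective (congrArg (fun p => (ofLex p).2) h)
  have lt_of_part : ∀ x y : Q.vertex, Q.part x < Q.part y → x < y := fun x y h =>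
    (Prod.Lex.toLex_lt_toLex (x := (Q.part x, e x)) (y := (Q.part y, e y))).mpr (Or.inl h)
  refine ⟨BinStr.ofLabel Q.label, ⟨Q.finite, inferInstanceAs
    (IsStrictTotalOrder Q.vertex (· < ·)), ?_, ?_, ?_, ?_⟩, fun χ => ?_⟩
  · exact fun x y h => h.symm
  · exact fun x h => h.elim (fun h => lt_irrefl _ h.1) fun h => lt_irrefl _ h.1
  · exact fun x h => h.elim (fun h => lt_irrefl _ h.1) fun h => lt_irrefl _ h.1
  · intro (x : Q.vertex) (y : Q.vertex) hxy
    change (x < y ∧ (Q.label x y).2) ∨ (y < x ∧ ¬ (Q.label y x).2) ↔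
      ¬ ((y < x ∧ (Q.label y x).2) ∨ (x < y ∧ ¬ (Q.label x y).2))
    rcases lt_or_gt_of_ne (α := Q.vertex) hxy with h | h <;> simp [h, h.not_gt]
  · obtain ⟨s, g, hg, hmono⟩ := hQ fun f =>
      if h : ∃ i : BinEmb A (BinStr.ofLabel Q.label), i.toFun = f then some (χ h.choose) else none
    have g_lt : StrictMono g := fun x y hxy =>
      lt_of_part _ _ (by rw [hg.1, hg.1]; exact s.strictMono hxy)
    let G : BinEmb B (BinStr.ofLabel Q.label) :=
      { toFun := g
        inj := g_lt.injective
        map_rel := by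
          intro i x y
          have h_lt : ∀ x y : B.carrier, x < y → Q.label (g x) (g y) = (B.rel 1 x y, B.rel 2 x y) :=
            hg.2
          fin_cases i
          · exact (g_lt.lt_iff_lt (a := x) (b := y)).symm
          · change B.rel 1 x y ↔ (g x < g y ∧ (Q.label (g x) (g y)).1) ∨
              (g y < g x ∧ (Q.label (g y) (g x)).1)
            rcases lt_trichotomy x y with h | rfl | h
            · simp [g_lt.lt_iff_lt, h, h.not_gt, h_lt _ _ h]
            · simp [hBi]
            · simp [g_lt.lt_iff_lt, h, h.not_gt, h_lt _ _ h,
                show B.rel 1 x y ↔ B.rel 1 y x from ⟨hBs _ _, hBs _ _⟩]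
          · change B.rel 2 x y ↔ (g x < g y ∧ (Q.label (g x) (g y)).2) ∨
              (g y < g x ∧ ¬ (Q.label (g y) (g x)).2)
            rcases lt_trichotomy x y with h | rfl | h
            · simp [g_lt.lt_iff_lt, h, h.not_gt, h_lt _ _ h]
            · simp [hBt]
            · simp [g_lt.lt_iff_lt, h, h.not_gt, h_lt _ _ h, hBT x y h.ne'] }
    refine ⟨G, fun f₁ f₂ => ?_⟩
    let O : BinEmb A B → (A.carrier ↪o B.carrier) := fun f =>
      OrderEmbedding.ofStrictMono f.toFun fun x y h => (f.map_rel 0 x y).mp h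
    have hO : ∀ (f : BinEmb A B) (i k : A.carrier), i < k →
        (B.rel 1 (O f i) (O f k), B.rel 2 (O f i) (O f k)) = (A.rel 1 i k, A.rel 2 i k) :=
      fun f i k _ => Prod.ext (propext (f.map_rel 1 i k).symm) (propext (f.map_rel 2 i k).symm)
    have key : ∀ f : BinEmb A B,
        (if h : ∃ i : BinEmb A (BinStr.ofLabel Q.label), i.toFun = g ∘ O f
          then some (χ h.choose) else none) = some (χ (G.comp f)) := by
      intro f
      have hex : ∃ i : BinEmb A (BinStr.ofLabel Q.label), i.toFun = g ∘ O f := ⟨G.comp f, rfl⟩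
      have ext_toFun : ∀ i i' : BinEmb A (BinStr.ofLabel Q.label), i.toFun = i'.toFun → i = i' := by
        rintro ⟨_, _, _⟩ ⟨_, _, _⟩ rfl
        rfl
      rw [dif_pos hex, ext_toFun _ (G.comp f) hex.choose_spec]
    have := hmono (O f₁) (O f₂) (hO f₁) (hO f₂)
    exact Option.some_injective _ ((key f₁).symm.trans (this.trans (key f₂)))
end
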